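/- arXiv:1708.03875 — 4 statements merged into one kernel-verified Lean document; each statement's English description precedes it below -/
import Mathlib

section
/- Set χ₀ := η⁻⁴·h₀ and χ₁ := η⁻⁴·h₁ where h₀ := 4ξ₂ − 2ξ₃ − 2ξ₄ and h₁ := 2ξ₃ − 2ξ₄, and define the 2×2 matrices of holomorphic functions on ℍ: K := [[χ₀, χ₁], [η⁻⁴·χ₀', η⁻⁴·χ₁']], C := [[1/6, 0], [0, 1]], and M := [[η⁻¹⁶·E4², η⁻¹²·E6], [η⁻¹²·E6, η⁻⁸·E4]]. Then (C·K)ᵀ · M · (C·K) = [[48, 0], [0, 16]] identically on ℍ. -/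
open Complex

noncomputable section

/-- `q = e^{2πiτ}`. -/
def qexp (τ : ℂ) : ℂ := Complex.exp (2 * ↑Real.pi * Complex.I * τ)

/-- `q^s = e^{2πisτ}` for real `s`. -/
def qpow (s : ℝ) (τ : ℂ) : ℂ := Complex.exp (2 * ↑Real.pi * Complex.I * ↑s * τ)

/-- The differential operator `f' = (1/(2πi)) df/dτ` (i.e. `q d/dq`). -/
def Dq (f : ℂ → ℂ) : ℂ → ℂ := fun τ => deriv f τ / (2 * ↑Real.pi * Complex.I)

/-- The divisor power sum `σ_k(n)`. -/
def sigma' (k n : ℕ) : ℕ := ∑ d ∈ n.divisors, d ^ k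

/-- The quasimodular Eisenstein series `E₂`. -/
def E2 (τ : ℂ) : ℂ := 1 - 24 * ∑' n : ℕ, (sigma' 1 (n + 1) : ℂ) * qexp τ ^ (n + 1)

/-- The Eisenstein series `E₄`. -/
def E4 (τ : ℂ) : ℂ := 1 + 240 * ∑' n : ℕ, (sigma' 3 (n + 1) : ℂ) * qexp τ ^ (n + 1)

/-- The Eisenstein series `E₆`. -/
def E6 (τ : ℂ) : ℂ := 1 - 504 * ∑' n : ℕ, (sigma' 5 (n + 1) : ℂ) * qexp τ ^ (n + 1)

/-- The Dedekind eta function `η(τ) = q^{1/24} ∏ (1 - qⁿ)`. -/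
def η (τ : ℂ) : ℂ := qpow (1/24) τ * ∏' n : ℕ, (1 - qexp τ ^ (n + 1))

/-- Theta constant `θ₂(τ) = Σ_{n∈ℤ} q^{(n-1/2)²/2}`. -/
def θ₂ (τ : ℂ) : ℂ := ∑' n : ℤ, qpow (((n : ℝ) - 1/2) ^ 2 / 2) τ

/-- Theta constant `θ₃(τ) = Σ_{n∈ℤ} q^{n²/2}`. -/
def θ₃ (τ : ℂ) : ℂ := ∑' n : ℤ, qpow ((n : ℝ) ^ 2 / 2) τ

/-- Theta constant `θ₄(τ) = Σ_{n∈ℤ} (-1)ⁿ q^{n²/2}`. -/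
def θ₄ (τ : ℂ) : ℂ := ∑' n : ℤ, (-1 : ℂ) ^ n * qpow ((n : ℝ) ^ 2 / 2) τ

/-- `ξ₂ = 2 θ₂'/θ₂`. -/
def ξ₂ : ℂ → ℂ := fun τ => 2 * Dq θ₂ τ / θ₂ τ

/-- `ξ₃ = 2 θ₃'/θ₃`. -/
def ξ₃ : ℂ → ℂ := fun τ => 2 * Dq θ₃ τ / θ₃ τ

/-- `ξ₄ = 2 θ₄'/θ₄`. -/
def ξ₄ : ℂ → ℂ := fun τ => 2 * Dq θ₄ τ / θ₄ τ

/-- `h₀ = 4ξ₂ - 2ξ₃ - 2ξ₄` (equal to `η⁴ χ_{Λ₀}^{q}`). -/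
def h₀ : ℂ → ℂ := fun τ => 4 * ξ₂ τ - 2 * ξ₃ τ - 2 * ξ₄ τ

/-- `h₁ = 2ξ₃ - 2ξ₄` (equal to `η⁴ χ_{Λ₁}^{q}`). -/
def h₁ : ℂ → ℂ := fun τ => 2 * ξ₃ τ - 2 * ξ₄ τ

/-- The Serre-type derivative `∂_k f = f' - (k/12) E₂ f`. -/
def partialD (k : ℂ) (f : ℂ → ℂ) : ℂ → ℂ := fun τ => Dq f τ - k / 12 * E2 τ * f τ

end

namespace ThetaConstant

open UpperHalfPlane hiding I
open Filter Topology Function ModularGroup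
open scoped Manifold MatrixGroups

section JacobiTheta

lemma θ₃_eq_jacobiTheta₂ (τ : ℂ) : θ₃ τ = jacobiTheta₂ 0 τ := by
  refine tsum_congr fun n => ?_
  simp only [qpow, jacobiTheta₂_term]
  congr 1
  push_cast
  ring

lemma θ₄_eq_jacobiTheta₂ (τ : ℂ) : θ₄ τ = jacobiTheta₂ (1 / 2) τ := by
  refine tsum_congr fun n => ?_
  have h : (-1 : ℂ) ^ n = cexp (n * (Real.pi * I)) := by
    rw [exp_int_mul, exp_pi_mul_I]
  rw [h, qpow, ← Complex.exp_add, jacobiTheta₂_term]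
  congr 1
  push_cast
  ring

lemma θ₂_eq_jacobiTheta₂ (τ : ℂ) :
    θ₂ τ = cexp (Real.pi * I * τ / 4) * jacobiTheta₂ (-τ / 2) τ := by
  rw [jacobiTheta₂, ← tsum_mul_left]
  refine tsum_congr fun n => ?_
  rw [qpow, jacobiTheta₂_term, ← Complex.exp_add]
  congr 1
  push_cast
  ring

lemma θ₃_add_one (τ : ℂ) : θ₃ (τ + 1) = θ₄ τ := by
  refine tsum_congr fun n => ?_
  have h : (-1 : ℂ) ^ n = cexp (Real.pi * I * n ^ 2) := by
    rw [show (Real.pi * I * n ^ 2 : ℂ) = (n ^ 2 : ℤ) * (Real.pi * I) by push_cast; ring,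
      exp_int_mul, exp_pi_mul_I, neg_one_zpow_eq_ite, neg_one_zpow_eq_ite]
    simp [Int.even_pow]
  rw [h, qpow, qpow, ← Complex.exp_add]
  congr 1
  push_cast
  ring

lemma θ₄_add_one (τ : ℂ) : θ₄ (τ + 1) = θ₃ τ := by
  rw [← θ₃_add_one, add_assoc, one_add_one_eq_two, θ₃_eq_jacobiTheta₂, θ₃_eq_jacobiTheta₂,
    jacobiTheta₂_add_right]

lemma θ₂_add_one_pow_four (τ : ℂ) : θ₂ (τ + 1) ^ 4 = -θ₂ τ ^ 4 := by
  have h : θ₂ (τ + 1) = cexp (Real.pi * I / 4) * θ₂ τ := by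
    rw [θ₂, θ₂, ← tsum_mul_left]
    refine tsum_congr fun n => ?_
    obtain ⟨m, hm⟩ := Int.even_mul_pred_self n
    have hm' : (n * (n - 1) : ℂ) = m + m := by exact_mod_cast hm
    rw [qpow, qpow, ← Complex.exp_add, Complex.exp_eq_exp_iff_exists_int]
    refine ⟨m, ?_⟩
    push_cast
    linear_combination (Real.pi * I) * hm'
  rw [h, mul_pow, ← Complex.exp_nat_mul]
  rw [show ((4 : ℕ) : ℂ) * (Real.pi * I / 4) = Real.pi * I by push_cast; ring, exp_pi_mul_I]
  ring

lemma neg_I_mul_cpow_half_pow_four (τ : ℂ) : ((-I * τ) ^ (1 / 2 : ℂ)) ^ 4 = -τ ^ 2 := by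
  rw [← Complex.cpow_nat_mul]
  norm_num
  rw [mul_pow, I_sq]
  ring

lemma θ₃_neg_inv_pow_four {τ : ℂ} (hτ : τ ≠ 0) : θ₃ (-τ)⁻¹ ^ 4 = -τ ^ 2 * θ₃ τ ^ 4 := by
  have h : (-τ)⁻¹ = -1 / τ := by field_simp
  have h0 : (-I * τ) ^ (1 / 2 : ℂ) ≠ 0 := by simp [Complex.cpow_eq_zero_iff, hτ]
  rw [θ₃_eq_jacobiTheta₂, θ₃_eq_jacobiTheta₂, h, jacobiTheta₂_functional_equation 0 τ, ←
    neg_I_mul_cpow_half_pow_four]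
  simp only [zero_div]
  norm_num
  field_simp

lemma θ₄_neg_inv_pow_four {τ : ℂ} (hτ : τ ≠ 0) : θ₄ (-τ)⁻¹ ^ 4 = -τ ^ 2 * θ₂ τ ^ 4 := by
  have h : (-τ)⁻¹ = -1 / τ := by field_simp
  have h0 : (-I * τ) ^ (1 / 2 : ℂ) ≠ 0 := by simp [Complex.cpow_eq_zero_iff, hτ]
  have h1 : -τ / 2 / τ = -(1 / 2) := by field_simp
  have h2 : cexp (Real.pi * I * τ / 4) * cexp (-Real.pi * I * (-τ / 2) ^ 2 / τ) = 1 := by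
    rw [← Complex.exp_add, ← Complex.exp_zero]
    congr 1
    field_simp
    ring
  rw [θ₄_eq_jacobiTheta₂, θ₂_eq_jacobiTheta₂, h, jacobiTheta₂_functional_equation (-τ / 2) τ, ←
    neg_I_mul_cpow_half_pow_four, h1, jacobiTheta₂_neg_left]
  have : cexp (Real.pi * I * τ / 4) * (1 / (-I * τ) ^ (1 / 2 : ℂ) *
      cexp (-Real.pi * I * (-τ / 2) ^ 2 / τ) * jacobiTheta₂ (1 / 2) (-1 / τ)) =
      1 / (-I * τ) ^ (1 / 2 : ℂ) * jacobiTheta₂ (1 / 2) (-1 / τ) := by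
    linear_combination (1 / (-I * τ) ^ (1 / 2 : ℂ) * jacobiTheta₂ (1 / 2) (-1 / τ)) * h2
  rw [this]
  field_simp

lemma θ₂_neg_inv_pow_four {τ : ℂ} (hτ : τ ≠ 0) : θ₂ (-τ)⁻¹ ^ 4 = -τ ^ 2 * θ₄ τ ^ 4 := by
  have h := θ₄_neg_inv_pow_four (inv_ne_zero (neg_ne_zero.mpr hτ))
  rw [← inv_neg, neg_neg, inv_inv] at h
  rw [h]
  field_simp

lemma differentiableAt_θ₃ {τ : ℂ} (hτ : 0 < τ.im) : DifferentiableAt ℂ θ₃ τ := by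
  rw [show θ₃ = jacobiTheta₂ 0 from funext θ₃_eq_jacobiTheta₂]
  exact differentiableAt_jacobiTheta₂_snd 0 hτ

lemma differentiableAt_θ₄ {τ : ℂ} (hτ : 0 < τ.im) : DifferentiableAt ℂ θ₄ τ := by
  rw [show θ₄ = jacobiTheta₂ (1 / 2) from funext θ₄_eq_jacobiTheta₂]
  exact differentiableAt_jacobiTheta₂_snd _ hτ

lemma differentiableAt_θ₂ {τ : ℂ} (hτ : 0 < τ.im) : DifferentiableAt ℂ θ₂ τ := by
  rw [show θ₂ = fun τ => cexp (Real.pi * I * τ / 4) * jacobiTheta₂ (-τ / 2) τ from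
    funext θ₂_eq_jacobiTheta₂]
  have h : DifferentiableAt ℂ (fun t : ℂ => (-t / 2, t)) τ := by fun_prop
  have := (hasFDerivAt_jacobiTheta₂ (-τ / 2) hτ).differentiableAt.comp (f := fun t : ℂ => (-t / 2, t)) τ h
  exact DifferentiableAt.mul (by fun_prop) this

lemma norm_qpow (s : ℝ) (τ : ℂ) : ‖qpow s τ‖ = Real.exp (-2 * Real.pi * s * τ.im) := by
  rw [qpow, Complex.norm_exp]
  congr 1
  simp

lemma tendsto_qpow_atImInfty {s : ℝ} (hs : 0 < s) :
    Tendsto (fun z : ℍ => qpow s z) atImInfty (𝓝 0) := by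
  rw [tendsto_zero_iff_norm_tendsto_zero]
  simp only [norm_qpow]
  refine Real.tendsto_exp_atBot.comp ?_
  refine Tendsto.const_mul_atTop_of_neg ?_ tendsto_comap
  nlinarith [Real.pi_pos, mul_pos Real.pi_pos hs]

lemma eventually_one_le_im : ∀ᶠ z : ℍ in atImInfty, 1 ≤ z.im :=
  tendsto_comap.eventually (eventually_ge_atTop 1)

lemma norm_qpow_le {s : ℝ} (hs : 0 ≤ s) {τ : ℂ} (hτ : 1 ≤ τ.im) : ‖qpow s τ‖ ≤ ‖qpow s I‖ := by
  rw [norm_qpow, norm_qpow, Real.exp_le_exp, Complex.I_im]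
  nlinarith [mul_nonneg Real.pi_pos.le hs]

lemma summable_norm_θ₃_I : Summable fun n : ℤ => ‖qpow ((n : ℝ) ^ 2 / 2) I‖ := by
  refine ((summable_jacobiTheta₂_term_iff 0 I).mpr (by simp)).norm.congr fun n => ?_
  simp only [qpow, jacobiTheta₂_term]
  congr 2
  push_cast
  ring

lemma summable_norm_θ₂_I : Summable fun n : ℤ => ‖qpow (((n : ℝ) - 1 / 2) ^ 2 / 2) I‖ := by
  refine (((summable_jacobiTheta₂_term_iff (-I / 2) I).mpr (by simp)).mul_left
    (cexp (Real.pi * I * I / 4))).norm.congr fun n => ?_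
  rw [qpow, jacobiTheta₂_term, ← Complex.exp_add]
  congr 2
  push_cast
  ring

lemma tendsto_θ₂_atImInfty : Tendsto (fun z : ℍ => θ₂ z) atImInfty (𝓝 0) := by
  rw [show (0 : ℂ) = ∑' _ : ℤ, (0 : ℂ) by simp]
  refine tendsto_tsum_of_dominated_convergence summable_norm_θ₂_I (fun n => ?_) ?_
  · refine tendsto_qpow_atImInfty ?_
    have : (n : ℝ) - 1 / 2 ≠ 0 := by
      intro h
      have : (2 * n : ℝ) = 1 := by linarith
      have : 2 * n = 1 := by exact_mod_cast this
      lia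
    positivity
  · filter_upwards [eventually_one_le_im] with z hz n
    exact norm_qpow_le (by positivity) hz

lemma tendsto_θ₃_atImInfty : Tendsto (fun z : ℍ => θ₃ z) atImInfty (𝓝 1) := by
  rw [show (1 : ℂ) = ∑' n : ℤ, if n = 0 then (1 : ℂ) else 0 by simp]
  refine tendsto_tsum_of_dominated_convergence summable_norm_θ₃_I (fun n => ?_) ?_
  · split_ifs with h
    · simp [h, qpow]
    · exact tendsto_qpow_atImInfty (by positivity)
  · filter_upwards [eventually_one_le_im] with z hz n
    exact norm_qpow_le (by positivity) hz

lemma tendsto_θ₄_atImInfty : Tendsto (fun z : ℍ => θ₄ z) atImInfty (𝓝 1) := by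
  have h : Tendsto (fun z : ℍ => (1 : ℝ) +ᵥ z) atImInfty atImInfty := by
    simp [atImInfty, tendsto_comap_iff, comp_def, tendsto_comap]
  refine (tendsto_θ₃_atImInfty.comp h).congr fun z => ?_
  simp [← θ₃_add_one, add_comm]

end JacobiTheta

section LevelOne

open scoped ModularForm

lemma slash_S_apply (F : ℍ → ℂ) (k : ℤ) (z : ℍ) :
    (F ∣[k] S) z = F (S • z) * (z : ℂ) ^ (-k) := by
  rw [ModularForm.SL_slash_apply, show denom S z = z by simp [denom, coe_S]]

lemma slash_T_apply (F : ℍ → ℂ) (k : ℤ) (z : ℍ) : (F ∣[k] T) z = F ((1 : ℝ) +ᵥ z) := by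
  rw [ModularForm.SL_slash_apply, show denom T z = 1 by simp [denom, coe_T], modular_T_smul]
  simp

/-- A level one form of weight less than twelve that vanishes at `i∞` is zero. -/
lemma eq_zero_of_weight_lt_twelve {k : ℤ} (hk : k < 12) {F : ℍ → ℂ} (hF : MDiff F)
    (hS : F ∣[k] S = F) (hT : F ∣[k] T = F) (h0 : Tendsto F atImInfty (𝓝 0)) : F = 0 := by
  let f : CuspForm 𝒮ℒ k :=
    { toFun := F
      slash_action_eq' := fun A hA => by
        obtain ⟨A, rfl⟩ := hA
        exact SlashInvariantForm.slash_action_generators_SL2Z hS hT A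
      holo' := hF
      zero_at_cusps' := fun hc => by
        rw [Subgroup.IsArithmetic.isCusp_iff_isCusp_SL2Z] at hc
        rw [OnePoint.isZeroAt_iff_forall_SL2Z hc]
        intro γ _
        rw [SlashInvariantForm.slash_action_generators_SL2Z hS hT]
        exact h0 }
  have hf : f = 0 := rank_zero_iff_forall_zero.mp (CuspForm.rank_eq_zero_of_weight_lt_twelve hk) f
  exact congrArg (fun g : CuspForm 𝒮ℒ k => (g : ℍ → ℂ)) hf

/-- `θ₂⁴` as a function on the upper half-plane. -/
noncomputable def fourthPowerθ₂ (z : ℍ) : ℂ := θ₂ z ^ 4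

/-- `θ₃⁴` as a function on the upper half-plane. -/
noncomputable def fourthPowerθ₃ (z : ℍ) : ℂ := θ₃ z ^ 4

/-- `θ₄⁴` as a function on the upper half-plane. -/
noncomputable def fourthPowerθ₄ (z : ℍ) : ℂ := θ₄ z ^ 4

local notation "Aθ" => fourthPowerθ₂
local notation "Bθ" => fourthPowerθ₄
local notation "Cθ" => fourthPowerθ₃

lemma mdifferentiable_of_differentiableAt {f : ℂ → ℂ}
    (hf : ∀ τ : ℂ, 0 < τ.im → DifferentiableAt ℂ f τ) : MDiff (fun z : ℍ => f z) := by
  rw [UpperHalfPlane.mdifferentiable_iff]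
  refine .congr (fun z hz => (hf z hz).differentiableWithinAt) fun z hz => ?_
  simp [ofComplex_apply_of_im_pos hz]

lemma mdifferentiable_fourthPowerθ₂ : MDiff Aθ :=
  mdifferentiable_of_differentiableAt fun _ h => (differentiableAt_θ₂ h).pow 4

lemma mdifferentiable_fourthPowerθ₃ : MDiff Cθ :=
  mdifferentiable_of_differentiableAt fun _ h => (differentiableAt_θ₃ h).pow 4

lemma mdifferentiable_fourthPowerθ₄ : MDiff Bθ :=
  mdifferentiable_of_differentiableAt fun _ h => (differentiableAt_θ₄ h).pow 4

lemma fourthPowerθ₂_slash_S : Aθ ∣[(2 : ℤ)] S = -Bθ := by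
  ext z
  have := z.ne_zero
  simp only [slash_S_apply, fourthPowerθ₂, fourthPowerθ₄, Pi.neg_apply, modular_S_smul, coe_mk,
    θ₂_neg_inv_pow_four this]
  field_simp

lemma fourthPowerθ₄_slash_S : Bθ ∣[(2 : ℤ)] S = -Aθ := by
  ext z
  have := z.ne_zero
  simp only [slash_S_apply, fourthPowerθ₂, fourthPowerθ₄, Pi.neg_apply, modular_S_smul, coe_mk,
    θ₄_neg_inv_pow_four this]
  field_simp

lemma fourthPowerθ₃_slash_S : Cθ ∣[(2 : ℤ)] S = -Cθ := by
  ext z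
  have := z.ne_zero
  simp only [slash_S_apply, fourthPowerθ₃, Pi.neg_apply, modular_S_smul, coe_mk,
    θ₃_neg_inv_pow_four this]
  field_simp

lemma fourthPowerθ₂_slash_T : Aθ ∣[(2 : ℤ)] T = -Aθ := by
  ext z
  simp [slash_T_apply, fourthPowerθ₂, add_comm (1 : ℂ), θ₂_add_one_pow_four]

lemma fourthPowerθ₃_slash_T : Cθ ∣[(2 : ℤ)] T = Bθ := by
  ext z
  simp [slash_T_apply, fourthPowerθ₃, fourthPowerθ₄, add_comm (1 : ℂ), θ₃_add_one]

lemma fourthPowerθ₄_slash_T : Bθ ∣[(2 : ℤ)] T = Cθ := by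
  ext z
  simp [slash_T_apply, fourthPowerθ₃, fourthPowerθ₄, add_comm (1 : ℂ), θ₄_add_one]

lemma tendsto_fourthPowerθ₂ : Tendsto Aθ atImInfty (𝓝 0) := by
  have h := tendsto_θ₂_atImInfty.pow 4
  norm_num at h
  exact h

lemma tendsto_fourthPowerθ₃ : Tendsto Cθ atImInfty (𝓝 1) := by
  have h := tendsto_θ₃_atImInfty.pow 4
  norm_num at h
  exact h

lemma tendsto_fourthPowerθ₄ : Tendsto Bθ atImInfty (𝓝 1) := by
  have h := tendsto_θ₄_atImInfty.pow 4
  norm_num at h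
  exact h

lemma tendsto_tsum_sigma_mul_cexp {k : ℕ} (hk : 1 ≤ k) :
    Tendsto (fun z : ℍ => ∑' n : ℕ+, (ArithmeticFunction.sigma (k - 1) n : ℂ) *
      cexp (2 * Real.pi * Complex.I * z) ^ (n : ℕ)) atImInfty (𝓝 0) := by
  rw [show (0 : ℂ) = ∑' _ : ℕ+, (0 : ℂ) by simp]
  have hq (z : ℍ) : cexp (2 * Real.pi * Complex.I * z) = qpow 1 z := by simp [qpow]
  have hsum : Summable fun n : ℕ+ => ‖(ArithmeticFunction.sigma (k - 1) n : ℂ) *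
      cexp (2 * Real.pi * Complex.I * UpperHalfPlane.I) ^ (n : ℕ)‖ :=
    ((EisensteinSeries.summable_sigma_mul_cexp_pow hk UpperHalfPlane.I).comp_injective
      PNat.coe_injective).norm
  refine tendsto_tsum_of_dominated_convergence hsum (fun n => ?_) ?_
  · simp only [hq]
    simpa using ((tendsto_qpow_atImInfty one_pos).pow n).const_mul _
  · filter_upwards [eventually_one_le_im] with z hz n
    simp only [hq, norm_mul, norm_pow]
    gcongr
    exact norm_qpow_le zero_le_one hz

lemma tendsto_E2_atImInfty : Tendsto EisensteinSeries.E2 atImInfty (𝓝 1) := by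
  have h := ((tendsto_tsum_sigma_mul_cexp (k := 2) (by norm_num)).const_mul 24).const_sub 1
  simp only [mul_zero, sub_zero] at h
  refine h.congr fun z => ?_
  rw [EisensteinSeries.E2_eq_tsum_cexp]

lemma E₄_eq_tsum (z : ℍ) : ModularForm.E₄ z = 1 + 240 * ∑' n : ℕ+,
    (ArithmeticFunction.sigma 3 n : ℂ) * cexp (2 * Real.pi * Complex.I * z) ^ (n : ℕ) := by
  have h := EisensteinSeries.q_expansion_bernoulli (k := 4) (by norm_num) (by decide) z
  rw [show bernoulli 4 = -1 / 30 by decide +kernel] at h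
  norm_num at h
  exact h

lemma E₆_eq_tsum (z : ℍ) : ModularForm.E₆ z = 1 - 504 * ∑' n : ℕ+,
    (ArithmeticFunction.sigma 5 n : ℂ) * cexp (2 * Real.pi * Complex.I * z) ^ (n : ℕ) := by
  have h := EisensteinSeries.q_expansion_bernoulli (k := 6) (by norm_num) (by decide) z
  rw [show bernoulli 6 = 1 / 42 by decide +kernel] at h
  norm_num at h
  exact h

lemma tendsto_E₄_atImInfty : Tendsto ModularForm.E₄ atImInfty (𝓝 1) := by
  have h := ((tendsto_tsum_sigma_mul_cexp (k := 4) (by norm_num)).const_mul 240).const_add 1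
  simp only [mul_zero, add_zero] at h
  exact h.congr fun z => (E₄_eq_tsum z).symm

lemma tendsto_E₆_atImInfty : Tendsto ModularForm.E₆ atImInfty (𝓝 1) := by
  have h := ((tendsto_tsum_sigma_mul_cexp (k := 6) (by norm_num)).const_mul 504).const_sub 1
  simp only [mul_zero, sub_zero] at h
  exact h.congr fun z => (E₆_eq_tsum z).symm

open Derivative

/-- The normalized derivative of a function with a limit at `i∞` tends to zero. -/
lemma tendsto_normalizedDerivOfComplex_atImInfty {F : ℍ → ℂ} (hF : MDiff F) {L : ℂ}
    (hL : Tendsto F atImInfty (𝓝 L)) :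
    Tendsto (normalizedDerivOfComplex F) atImInfty (𝓝 0) := by
  suffices h : Tendsto (fun z : ℍ => deriv (F ∘ ofComplex) z) atImInfty (𝓝 0) by
    have h' := h.const_mul (2 * Real.pi * Complex.I : ℂ)⁻¹
    rw [mul_zero] at h'
    exact h'
  rw [Metric.tendsto_nhds] at hL ⊢
  intro ε hε
  obtain ⟨M, hM⟩ := (atImInfty_mem _).mp (hL (ε / 2) (half_pos hε))
  refine (atImInfty_mem _).mpr ⟨max M 0 + 2, fun z hz => ?_⟩
  have him (w : ℂ) (hw : w ∈ Metric.closedBall (z : ℂ) 1) : max M 0 < w.im := by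
    have h1 := (abs_im_le_norm (w - z)).trans (mem_closedBall_iff_norm.mp hw)
    have h2 : (z : ℂ).im = z.im := rfl
    rw [sub_im, h2, abs_le] at h1
    linarith [h1.1]
  have hpos (w : ℂ) (hw : w ∈ Metric.closedBall (z : ℂ) 1) : 0 < w.im :=
    (le_max_right _ _).trans_lt (him w hw)
  have hdiff : DifferentiableOn ℂ (fun w => (F ∘ ofComplex) w - L) (Metric.closedBall (z : ℂ) 1) :=
    ((UpperHalfPlane.mdifferentiable_iff.mp hF).mono hpos).sub_const L
  have hbound := Complex.norm_deriv_le_of_forall_mem_sphere_norm_le (C := ε / 2) one_pos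
    (hdiff.diffContOnCl_ball subset_rfl) fun w hw => by
      have hw' := Metric.sphere_subset_closedBall hw
      have := hM ⟨w, hpos w hw'⟩ ((le_max_left _ _).trans (him w hw').le)
      rw [Set.mem_ofPred_eq, dist_eq_norm] at this
      simpa [ofComplex_apply_of_im_pos (hpos w hw')] using this.le
  rw [deriv_sub_const_fun] at hbound
  simpa [dist_eq_norm] using lt_of_le_of_lt hbound (by linarith)

lemma tendsto_serreDerivative_atImInfty (k : ℂ) {F : ℍ → ℂ} (hF : MDiff F) {L : ℂ}
    (hL : Tendsto F atImInfty (𝓝 L)) :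
    Tendsto (serreDerivative k F) atImInfty (𝓝 (-(k / 12 * L))) := by
  have h := (tendsto_normalizedDerivOfComplex_atImInfty hF hL).sub
    ((tendsto_E2_atImInfty.const_mul (k * 12⁻¹)).mul hL)
  simpa [div_eq_mul_inv] using! h

lemma serreDerivative_two_slash {F G : ℍ → ℂ} (hF : MDiff F) {γ : SL(2, ℤ)}
    (h : F ∣[(2 : ℤ)] γ = G) :
    serreDerivative 2 F ∣[(4 : ℤ)] γ = serreDerivative 2 G := by
  have := serreDerivative_slash_equivariant (k := 2) hF (γ := γ)
  rw [h] at this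
  exact_mod_cast this

lemma serreDerivative_neg (k : ℂ) {F : ℍ → ℂ} (hF : MDiff F) :
    serreDerivative k (-F) = -serreDerivative k F := by
  have := serreDerivative_smul k (-1) F hF
  simpa using! this

local notation "Pθ" => serreDerivative 2 Aθ
local notation "Rθ" => serreDerivative 2 Bθ
local notation "Qθ" => serreDerivative 2 Cθ

lemma serreDerivative_fourthPowerθ₂_slash_S : Pθ ∣[(4 : ℤ)] S = -Rθ := by
  rw [serreDerivative_two_slash mdifferentiable_fourthPowerθ₂ fourthPowerθ₂_slash_S,
    serreDerivative_neg _ mdifferentiable_fourthPowerθ₄]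

lemma serreDerivative_fourthPowerθ₄_slash_S : Rθ ∣[(4 : ℤ)] S = -Pθ := by
  rw [serreDerivative_two_slash mdifferentiable_fourthPowerθ₄ fourthPowerθ₄_slash_S,
    serreDerivative_neg _ mdifferentiable_fourthPowerθ₂]

lemma serreDerivative_fourthPowerθ₃_slash_S : Qθ ∣[(4 : ℤ)] S = -Qθ := by
  rw [serreDerivative_two_slash mdifferentiable_fourthPowerθ₃ fourthPowerθ₃_slash_S,
    serreDerivative_neg _ mdifferentiable_fourthPowerθ₃]

lemma serreDerivative_fourthPowerθ₂_slash_T : Pθ ∣[(4 : ℤ)] T = -Pθ := by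
  rw [serreDerivative_two_slash mdifferentiable_fourthPowerθ₂ fourthPowerθ₂_slash_T,
    serreDerivative_neg _ mdifferentiable_fourthPowerθ₂]

lemma serreDerivative_fourthPowerθ₃_slash_T : Qθ ∣[(4 : ℤ)] T = Rθ :=
  serreDerivative_two_slash mdifferentiable_fourthPowerθ₃ fourthPowerθ₃_slash_T

lemma serreDerivative_fourthPowerθ₄_slash_T : Rθ ∣[(4 : ℤ)] T = Qθ :=
  serreDerivative_two_slash mdifferentiable_fourthPowerθ₄ fourthPowerθ₄_slash_T

lemma jacobi_identity : Cθ = Aθ + Bθ := by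
  have hA := mdifferentiable_fourthPowerθ₂
  have hB := mdifferentiable_fourthPowerθ₄
  have hC := mdifferentiable_fourthPowerθ₃
  have h : (Cθ - Aθ - Bθ) * (Cθ - Aθ - Bθ) = 0 := by
    refine eq_zero_of_weight_lt_twelve (k := 2 + 2) (by norm_num)
      (((hC.sub hA).sub hB).mul ((hC.sub hA).sub hB)) ?_ ?_ ?_
    · rw [ModularForm.mul_slash_SL2]
      simp only [sub_eq_add_neg, SlashAction.add_slash, SlashAction.neg_slash,
        fourthPowerθ₂_slash_S, fourthPowerθ₃_slash_S, fourthPowerθ₄_slash_S]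
      ring
    · rw [ModularForm.mul_slash_SL2]
      simp only [sub_eq_add_neg, SlashAction.add_slash, SlashAction.neg_slash,
        fourthPowerθ₂_slash_T, fourthPowerθ₃_slash_T, fourthPowerθ₄_slash_T]
      ring
    · have h1 := (tendsto_fourthPowerθ₃.sub tendsto_fourthPowerθ₂).sub tendsto_fourthPowerθ₄
      simpa using! h1.mul h1
  ext z
  have hz := congrFun h z
  simp only [Pi.mul_apply, Pi.sub_apply, Pi.zero_apply, mul_self_eq_zero] at hz
  simp only [Pi.add_apply]
  linear_combination hz

lemma serreDerivative_fourthPowerθ₃ : Qθ = Pθ + Rθ := by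
  rw [← serreDerivative_add _ _ _ mdifferentiable_fourthPowerθ₂ mdifferentiable_fourthPowerθ₄,
    jacobi_identity]

local notation "E₄θ" => Aθ * Aθ + Bθ * Bθ + Cθ * Cθ
local notation "E₆θ" => (Bθ + Cθ) * ((Cθ + Aθ) * (Bθ - Aθ))

lemma thetaE₄_slash (γ : SL(2, ℤ)) : E₄θ ∣[(2 + 2 : ℤ)] γ =
    (Aθ ∣[(2 : ℤ)] γ) * (Aθ ∣[(2 : ℤ)] γ) + (Bθ ∣[(2 : ℤ)] γ) * (Bθ ∣[(2 : ℤ)] γ) +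
      (Cθ ∣[(2 : ℤ)] γ) * (Cθ ∣[(2 : ℤ)] γ) := by
  simp only [SlashAction.add_slash, ModularForm.mul_slash_SL2]

lemma thetaE₆_slash (γ : SL(2, ℤ)) : E₆θ ∣[(2 + (2 + 2) : ℤ)] γ =
    (Bθ ∣[(2 : ℤ)] γ + Cθ ∣[(2 : ℤ)] γ) *
      ((Cθ ∣[(2 : ℤ)] γ + Aθ ∣[(2 : ℤ)] γ) * (Bθ ∣[(2 : ℤ)] γ - Aθ ∣[(2 : ℤ)] γ)) := by
  rw [ModularForm.mul_slash_SL2, ModularForm.mul_slash_SL2]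
  simp only [sub_eq_add_neg, SlashAction.add_slash, SlashAction.neg_slash]

lemma mdifferentiable_thetaE₄ : MDiff E₄θ := by
  have hA := mdifferentiable_fourthPowerθ₂
  have hB := mdifferentiable_fourthPowerθ₄
  have hC := mdifferentiable_fourthPowerθ₃
  exact ((hA.mul hA).add (hB.mul hB)).add (hC.mul hC)

lemma mdifferentiable_thetaE₆ : MDiff E₆θ := by
  have hA := mdifferentiable_fourthPowerθ₂
  have hB := mdifferentiable_fourthPowerθ₄
  have hC := mdifferentiable_fourthPowerθ₃
  exact (hB.add hC).mul ((hC.add hA).mul (hB.sub hA))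

lemma tendsto_thetaE₄ : Tendsto E₄θ atImInfty (𝓝 2) := by
  have hA := tendsto_fourthPowerθ₂
  have hB := tendsto_fourthPowerθ₄
  have hC := tendsto_fourthPowerθ₃
  have := ((hA.mul hA).add (hB.mul hB)).add (hC.mul hC)
  norm_num at this
  exact this

lemma tendsto_thetaE₆ : Tendsto E₆θ atImInfty (𝓝 2) := by
  have hA := tendsto_fourthPowerθ₂
  have hB := tendsto_fourthPowerθ₄
  have hC := tendsto_fourthPowerθ₃
  have := (hB.add hC).mul ((hC.add hA).mul (hB.sub hA))
  norm_num at this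
  exact this

lemma levelOne_slash {k : ℤ} (f : ModularForm 𝒮ℒ k) (γ : SL(2, ℤ)) : (f : ℍ → ℂ) ∣[k] γ = f :=
  SlashInvariantForm.slash_action_eqn f _ ⟨γ, rfl⟩

lemma two_mul_E₄ : (2 : ℂ) • (ModularForm.E₄ : ℍ → ℂ) = E₄θ := by
  have hE (γ : SL(2, ℤ)) : (ModularForm.E₄ : ℍ → ℂ) ∣[(2 + 2 : ℤ)] γ = ModularForm.E₄ :=
    levelOne_slash _ γ
  rw [← sub_eq_zero]
  refine eq_zero_of_weight_lt_twelve (k := 2 + 2) (by norm_num)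
    ((ModularForm.E₄.holo'.const_smul 2).sub mdifferentiable_thetaE₄) ?_ ?_ ?_
  · rw [sub_eq_add_neg, SlashAction.add_slash, SlashAction.neg_slash, thetaE₄_slash,
      ModularForm.SL_smul_slash, hE, fourthPowerθ₂_slash_S, fourthPowerθ₃_slash_S,
      fourthPowerθ₄_slash_S]
    ring
  · rw [sub_eq_add_neg, SlashAction.add_slash, SlashAction.neg_slash, thetaE₄_slash,
      ModularForm.SL_smul_slash, hE, fourthPowerθ₂_slash_T, fourthPowerθ₃_slash_T,
      fourthPowerθ₄_slash_T]
    ring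
  · have h := (tendsto_E₄_atImInfty.const_smul (2 : ℂ)).sub tendsto_thetaE₄
    simpa using! h

lemma two_mul_E₆ : (2 : ℂ) • (ModularForm.E₆ : ℍ → ℂ) = E₆θ := by
  have hE (γ : SL(2, ℤ)) : (ModularForm.E₆ : ℍ → ℂ) ∣[(2 + (2 + 2) : ℤ)] γ = ModularForm.E₆ :=
    levelOne_slash _ γ
  rw [← sub_eq_zero]
  refine eq_zero_of_weight_lt_twelve (k := 2 + (2 + 2)) (by norm_num)
    ((ModularForm.E₆.holo'.const_smul 2).sub mdifferentiable_thetaE₆) ?_ ?_ ?_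
  · rw [sub_eq_add_neg, SlashAction.add_slash, SlashAction.neg_slash, thetaE₆_slash,
      ModularForm.SL_smul_slash, hE, fourthPowerθ₂_slash_S, fourthPowerθ₃_slash_S,
      fourthPowerθ₄_slash_S]
    ring
  · rw [sub_eq_add_neg, SlashAction.add_slash, SlashAction.neg_slash, thetaE₆_slash,
      ModularForm.SL_smul_slash, hE, fourthPowerθ₂_slash_T, fourthPowerθ₃_slash_T,
      fourthPowerθ₄_slash_T]
    ring
  · have h := (tendsto_E₆_atImInfty.const_smul (2 : ℂ)).sub tendsto_thetaE₆
    simpa using! h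

lemma apply_S_smul_of_slash {k : ℕ} {F G : ℍ → ℂ} (h : F ∣[(k : ℤ)] S = G) (z : ℍ) :
    F (S • z) = (z : ℂ) ^ k * G z := by
  have hz := congrFun h z
  rw [slash_S_apply, zpow_neg, zpow_natCast] at hz
  have := z.ne_zero
  rw [← hz]
  field_simp

lemma apply_vadd_of_slash {k : ℤ} {F G : ℍ → ℂ} (h : F ∣[k] T = G) (z : ℍ) :
    F ((1 : ℝ) +ᵥ z) = G z := by
  rw [← h, slash_T_apply]

lemma eq_zero_of_apply_eq {k : ℕ} (hk : k < 12) {F : ℍ → ℂ} (hF : MDiff F)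
    (hS : ∀ z : ℍ, F (S • z) = (z : ℂ) ^ k * F z) (hT : ∀ z : ℍ, F ((1 : ℝ) +ᵥ z) = F z)
    (h0 : Tendsto F atImInfty (𝓝 0)) : F = 0 := by
  refine eq_zero_of_weight_lt_twelve (k := k) (by exact_mod_cast hk) hF ?_ ?_ h0
  · ext z
    have := z.ne_zero
    rw [slash_S_apply, hS, zpow_neg, zpow_natCast]
    field_simp
  · ext z
    rw [slash_T_apply, hT]

lemma serreDerivative_weight_six_relation (z : ℍ) :
    6 * (Aθ z * Pθ z + Bθ z * Rθ z + Cθ z * Qθ z) +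
      (Bθ z + Cθ z) * ((Cθ z + Aθ z) * (Bθ z - Aθ z)) = 0 := by
  have hA := mdifferentiable_fourthPowerθ₂
  have hB := mdifferentiable_fourthPowerθ₄
  have hC := mdifferentiable_fourthPowerθ₃
  have hP := serreDerivative_mdifferentiable 2 hA
  have hR := serreDerivative_mdifferentiable 2 hB
  have hQ := serreDerivative_mdifferentiable 2 hC
  refine congrFun (f := (6 : ℂ) • (Aθ * Pθ + Bθ * Rθ + Cθ * Qθ) + E₆θ)
    (eq_zero_of_apply_eq (k := 6) (by norm_num) ?_ (fun z => ?_) (fun z => ?_) ?_) z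
  · exact ((((hA.mul hP).add (hB.mul hR)).add (hC.mul hQ)).const_smul _).add mdifferentiable_thetaE₆
  · simp only [Pi.add_apply, Pi.mul_apply, Pi.sub_apply, Pi.smul_apply, smul_eq_mul,
      apply_S_smul_of_slash (k := 2) fourthPowerθ₂_slash_S,
      apply_S_smul_of_slash (k := 2) fourthPowerθ₃_slash_S,
      apply_S_smul_of_slash (k := 2) fourthPowerθ₄_slash_S,
      apply_S_smul_of_slash (k := 4) serreDerivative_fourthPowerθ₂_slash_S,
      apply_S_smul_of_slash (k := 4) serreDerivative_fourthPowerθ₃_slash_S,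
      apply_S_smul_of_slash (k := 4) serreDerivative_fourthPowerθ₄_slash_S, Pi.neg_apply]
    ring
  · simp only [Pi.add_apply, Pi.mul_apply, Pi.sub_apply, Pi.smul_apply, smul_eq_mul,
      apply_vadd_of_slash fourthPowerθ₂_slash_T, apply_vadd_of_slash fourthPowerθ₃_slash_T,
      apply_vadd_of_slash fourthPowerθ₄_slash_T,
      apply_vadd_of_slash serreDerivative_fourthPowerθ₂_slash_T,
      apply_vadd_of_slash serreDerivative_fourthPowerθ₃_slash_T,
      apply_vadd_of_slash serreDerivative_fourthPowerθ₄_slash_T, Pi.neg_apply]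
    ring
  · have tA := tendsto_fourthPowerθ₂
    have tB := tendsto_fourthPowerθ₄
    have tC := tendsto_fourthPowerθ₃
    have h := ((((tA.mul (tendsto_serreDerivative_atImInfty 2 hA tA)).add
      (tB.mul (tendsto_serreDerivative_atImInfty 2 hB tB))).add
      (tC.mul (tendsto_serreDerivative_atImInfty 2 hC tC))).const_smul (6 : ℂ)).add tendsto_thetaE₆
    convert! h using 2
    norm_num

lemma serreDerivative_weight_eight_relation (z : ℍ) :
    4 * ((Rθ z + Qθ z) * ((Cθ z + Aθ z) * (Bθ z - Aθ z)) +
      (Bθ z + Cθ z) * ((Qθ z + Pθ z) * (Bθ z - Aθ z)) +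
      (Bθ z + Cθ z) * ((Cθ z + Aθ z) * (Rθ z - Pθ z))) +
      (Aθ z * Aθ z + Bθ z * Bθ z + Cθ z * Cθ z) *
        (Aθ z * Aθ z + Bθ z * Bθ z + Cθ z * Cθ z) = 0 := by
  have hA := mdifferentiable_fourthPowerθ₂
  have hB := mdifferentiable_fourthPowerθ₄
  have hC := mdifferentiable_fourthPowerθ₃
  have hP := serreDerivative_mdifferentiable 2 hA
  have hR := serreDerivative_mdifferentiable 2 hB
  have hQ := serreDerivative_mdifferentiable 2 hC
  refine congrFun (f := (4 : ℂ) • ((Rθ + Qθ) * ((Cθ + Aθ) * (Bθ - Aθ)) +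
    (Bθ + Cθ) * ((Qθ + Pθ) * (Bθ - Aθ)) + (Bθ + Cθ) * ((Cθ + Aθ) * (Rθ - Pθ))) + E₄θ * E₄θ)
    (eq_zero_of_apply_eq (k := 8) (by norm_num) ?_ (fun z => ?_) (fun z => ?_) ?_) z
  · exact (((((hR.add hQ).mul ((hC.add hA).mul (hB.sub hA))).add
      ((hB.add hC).mul ((hQ.add hP).mul (hB.sub hA)))).add
      ((hB.add hC).mul ((hC.add hA).mul (hR.sub hP)))).const_smul _).add
      (mdifferentiable_thetaE₄.mul mdifferentiable_thetaE₄)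
  · simp only [Pi.add_apply, Pi.mul_apply, Pi.sub_apply, Pi.smul_apply, smul_eq_mul,
      apply_S_smul_of_slash (k := 2) fourthPowerθ₂_slash_S,
      apply_S_smul_of_slash (k := 2) fourthPowerθ₃_slash_S,
      apply_S_smul_of_slash (k := 2) fourthPowerθ₄_slash_S,
      apply_S_smul_of_slash (k := 4) serreDerivative_fourthPowerθ₂_slash_S,
      apply_S_smul_of_slash (k := 4) serreDerivative_fourthPowerθ₃_slash_S,
      apply_S_smul_of_slash (k := 4) serreDerivative_fourthPowerθ₄_slash_S, Pi.neg_apply]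
    ring
  · simp only [Pi.add_apply, Pi.mul_apply, Pi.sub_apply, Pi.smul_apply, smul_eq_mul,
      apply_vadd_of_slash fourthPowerθ₂_slash_T, apply_vadd_of_slash fourthPowerθ₃_slash_T,
      apply_vadd_of_slash fourthPowerθ₄_slash_T,
      apply_vadd_of_slash serreDerivative_fourthPowerθ₂_slash_T,
      apply_vadd_of_slash serreDerivative_fourthPowerθ₃_slash_T,
      apply_vadd_of_slash serreDerivative_fourthPowerθ₄_slash_T, Pi.neg_apply]
    ring
  · have tA := tendsto_fourthPowerθ₂
    have tB := tendsto_fourthPowerθ₄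
    have tC := tendsto_fourthPowerθ₃
    have tP := tendsto_serreDerivative_atImInfty 2 hA tA
    have tR := tendsto_serreDerivative_atImInfty 2 hB tB
    have tQ := tendsto_serreDerivative_atImInfty 2 hC tC
    have h := (((((tR.add tQ).mul ((tC.add tA).mul (tB.sub tA))).add
      ((tB.add tC).mul ((tQ.add tP).mul (tB.sub tA)))).add
      ((tB.add tC).mul ((tC.add tA).mul (tR.sub tP)))).const_smul (4 : ℂ)).add
      (tendsto_thetaE₄.mul tendsto_thetaE₄)
    convert! h using 2
    norm_num

lemma eta_pow_eq_fourthPower (z : ℍ) :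
    256 * ModularForm.eta z ^ 24 = (Aθ z * Bθ z * Cθ z) ^ 2 := by
  have h := ModularForm.discriminant_eq_E₄_cube_sub_E₆_sq z
  have h4 := congrFun two_mul_E₄ z
  have h6 := congrFun two_mul_E₆ z
  have hJ := congrFun jacobi_identity z
  simp only [ModularForm.discriminant, Pi.add_apply, Pi.mul_apply, Pi.sub_apply, Pi.smul_apply,
    smul_eq_mul] at h h4 h6 hJ
  rw [h, eq_div_of_mul_eq two_ne_zero ((mul_comm _ _).trans h4),
    eq_div_of_mul_eq two_ne_zero ((mul_comm _ _).trans h6), hJ]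
  ring

lemma fourthPower_mul_ne_zero (z : ℍ) : Aθ z * Bθ z * Cθ z ≠ 0 := by
  intro h
  have := eta_pow_eq_fourthPower z
  rw [h] at this
  have h0 := ModularForm.eta_ne_zero z.im_pos
  simp_all

lemma serreDerivative_fourthPowerθ₂_and_θ₄ (z : ℍ) :
    Pθ z = Aθ z * (Bθ z + Cθ z) / 6 ∧ Rθ z = -(Bθ z * (Aθ z + Cθ z)) / 6 := by
  have h6 := serreDerivative_weight_six_relation z
  have h8 := serreDerivative_weight_eight_relation z
  have hJ := congrFun jacobi_identity z
  have hQ := congrFun serreDerivative_fourthPowerθ₃ z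
  have h0 := fourthPower_mul_ne_zero z
  simp only [Pi.add_apply] at hJ hQ
  rw [hJ, hQ] at h6 h8
  rw [hJ] at h0 ⊢
  generalize Pθ z = p at *
  generalize Rθ z = r at *
  generalize Aθ z = a at *
  generalize Bθ z = b at *
  constructor
  · refine mul_left_cancel₀ h0 ?_
    linear_combination ((-3 * a ^ 2 + 6 * a * b + 6 * b ^ 2) * h6 / 6 - (a + 2 * b) * h8 / 4) / 27
  · refine mul_left_cancel₀ h0 ?_
    linear_combination ((2 * a + b) * h8 / 4 - (-6 * a ^ 2 - 6 * a * b + 3 * b ^ 2) * h6 / 6) / 27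

end LevelOne

section Characters

open Derivative

lemma η_eq_eta : η = ModularForm.eta := by
  ext τ
  rw [η, ModularForm.eta]
  congr 1
  · rw [qpow, Function.Periodic.qParam]
    congr 1
    push_cast
    ring
  · refine tprod_congr fun n => ?_
    rw [ModularForm.eta_q_eq_pow, qexp]

lemma tsum_sigma'_eq (k : ℕ) (z : ℍ) :
    ∑' n : ℕ, (sigma' k (n + 1) : ℂ) * qexp z ^ (n + 1) =
      ∑' n : ℕ+, (ArithmeticFunction.sigma k n : ℂ) *
        cexp (2 * Real.pi * Complex.I * z) ^ (n : ℕ) := by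
  rw [tsum_pnat_eq_tsum_succ (f := fun n : ℕ => (ArithmeticFunction.sigma k n : ℂ) *
    cexp (2 * Real.pi * Complex.I * z) ^ n)]
  simp only [sigma', qexp, ArithmeticFunction.sigma_apply]

lemma E4_eq_E₄ (z : ℍ) : E4 z = ModularForm.E₄ z := by
  rw [E4, tsum_sigma'_eq, E₄_eq_tsum]

lemma E6_eq_E₆ (z : ℍ) : E6 z = ModularForm.E₆ z := by
  rw [E6, tsum_sigma'_eq, E₆_eq_tsum]

lemma η_ne_zero (z : ℍ) : η z ≠ 0 := by
  rw [η_eq_eta]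
  exact ModularForm.eta_ne_zero z.im_pos

lemma hasDerivAt_inv_η_pow_four (z : ℍ) :
    HasDerivAt (fun t => (η t ^ 4)⁻¹)
      (2 * Real.pi * Complex.I * (-(EisensteinSeries.E2 z / 6) * (η z ^ 4)⁻¹)) z := by
  have h0 := η_ne_zero z
  have hd : HasDerivAt η (deriv η z) z := by
    rw [η_eq_eta]
    exact (ModularForm.differentiableAt_eta_of_mem_upperHalfPlaneSet z.im_pos).hasDerivAt
  have hE := ModularForm.logDeriv_eta_eq_E2 z
  rw [← η_eq_eta, logDeriv_apply, div_eq_iff h0] at hE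
  rw [hE] at hd
  convert! (hd.pow 4).inv (pow_ne_zero 4 h0) using 1
  rw [Pi.pow_apply]
  field_simp
  push_cast
  ring

lemma hasDerivAt_pow_four {f : ℂ → ℂ} (z : ℍ) (hf : DifferentiableAt ℂ f z) :
    HasDerivAt (fun t => f t ^ 4) (2 * Real.pi * Complex.I *
      (serreDerivative 2 (fun w : ℍ => f w ^ 4) z + EisensteinSeries.E2 z / 6 * f z ^ 4)) z := by
  have he : (fun w : ℍ => f w ^ 4) ∘ ofComplex =ᶠ[𝓝 (z : ℂ)] fun t => f t ^ 4 := by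
    filter_upwards [isOpen_upperHalfPlaneSet.mem_nhds z.im_pos] with w hw
    simp [ofComplex_apply_of_im_pos hw]
  have hd := (hf.pow 4).hasDerivAt
  convert! hd using 1
  rw [serreDerivative_apply, normalizedDerivOfComplex, he.deriv_eq]
  have := Real.pi_ne_zero
  change _ = deriv (fun t => f t ^ 4) z
  field_simp
  ring

lemma two_mul_Dq_div {f : ℂ → ℂ} (z : ℍ) (hf : DifferentiableAt ℂ f z) (h0 : f z ≠ 0) {s : ℂ}
    (hs : serreDerivative 2 (fun w : ℍ => f w ^ 4) z = f z ^ 4 * s / 6) :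
    2 * Dq f z / f z = (EisensteinSeries.E2 z + s) / 12 := by
  have h := (hasDerivAt_pow_four z hf).unique (hf.hasDerivAt.pow 4)
  rw [hs] at h
  have hpi : (2 * Real.pi * Complex.I : ℂ) ≠ 0 := two_pi_I_ne_zero
  rw [Dq, div_eq_div_iff h0 (by norm_num), mul_div_assoc', div_mul_eq_mul_div,
    div_eq_iff hpi]
  refine mul_left_cancel₀ (pow_ne_zero 3 h0) ?_
  push_cast at h
  linear_combination (-6) * h

lemma Dq_inv_η_pow_four_mul {g u : ℂ → ℂ} (z : ℍ) (hg : g =ᶠ[𝓝 (z : ℂ)] u) {s : ℂ}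
    (hu : HasDerivAt u (2 * Real.pi * Complex.I * (s + EisensteinSeries.E2 z / 6 * u z)) z) :
    Dq (fun t => (η t ^ 4)⁻¹ * g t) z = (η z ^ 4)⁻¹ * s := by
  have he : (fun t => (η t ^ 4)⁻¹ * g t) =ᶠ[𝓝 (z : ℂ)] fun t => (η t ^ 4)⁻¹ * u t :=
    hg.mono fun t ht => by simp only [ht]
  rw [Dq, he.deriv_eq, ((hasDerivAt_inv_η_pow_four z).fun_mul hu).deriv, div_eq_iff two_pi_I_ne_zero]
  ring

lemma theta_ne_zero (z : ℍ) : θ₂ z ≠ 0 ∧ θ₃ z ≠ 0 ∧ θ₄ z ≠ 0 := by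
  have h := fourthPower_mul_ne_zero z
  simp only [fourthPowerθ₂, fourthPowerθ₃, fourthPowerθ₄] at h
  refine ⟨?_, ?_, ?_⟩ <;> rintro h0 <;> simp [h0] at h

lemma θ₃_pow_four (z : ℍ) : θ₃ z ^ 4 = θ₂ z ^ 4 + θ₄ z ^ 4 := congrFun jacobi_identity z

lemma serreDerivative_θ₂_pow_four (z : ℍ) : serreDerivative 2 (fun w : ℍ => θ₂ w ^ 4) z =
    θ₂ z ^ 4 * (θ₄ z ^ 4 + θ₃ z ^ 4) / 6 :=
  (serreDerivative_fourthPowerθ₂_and_θ₄ z).1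

lemma serreDerivative_θ₄_pow_four (z : ℍ) : serreDerivative 2 (fun w : ℍ => θ₄ w ^ 4) z =
    θ₄ z ^ 4 * (-(θ₂ z ^ 4 + θ₃ z ^ 4)) / 6 := by
  rw [mul_neg]
  exact (serreDerivative_fourthPowerθ₂_and_θ₄ z).2

lemma serreDerivative_θ₃_pow_four (z : ℍ) : serreDerivative 2 (fun w : ℍ => θ₃ w ^ 4) z =
    θ₃ z ^ 4 * (θ₂ z ^ 4 - θ₄ z ^ 4) / 6 := by
  refine (congrFun serreDerivative_fourthPowerθ₃ z).trans ?_
  refine (congrArg₂ (· + ·) (serreDerivative_θ₂_pow_four z)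
    (serreDerivative_θ₄_pow_four z)).trans ?_
  simp only [θ₃_pow_four]
  ring

lemma ξ₂_eq (z : ℍ) : ξ₂ z = (EisensteinSeries.E2 z + (θ₄ z ^ 4 + θ₃ z ^ 4)) / 12 :=
  two_mul_Dq_div z (differentiableAt_θ₂ z.im_pos) (theta_ne_zero z).1 (serreDerivative_θ₂_pow_four z)

lemma ξ₃_eq (z : ℍ) : ξ₃ z = (EisensteinSeries.E2 z + (θ₂ z ^ 4 - θ₄ z ^ 4)) / 12 :=
  two_mul_Dq_div z (differentiableAt_θ₃ z.im_pos) (theta_ne_zero z).2.1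
    (serreDerivative_θ₃_pow_four z)

lemma ξ₄_eq (z : ℍ) : ξ₄ z = (EisensteinSeries.E2 z + -(θ₂ z ^ 4 + θ₃ z ^ 4)) / 12 :=
  two_mul_Dq_div z (differentiableAt_θ₄ z.im_pos) (theta_ne_zero z).2.2
    (serreDerivative_θ₄_pow_four z)

lemma h₀_eq {τ : ℂ} (hτ : 0 < τ.im) : h₀ τ = (θ₄ τ ^ 4 + θ₃ τ ^ 4) / 2 := by
  have h2 := ξ₂_eq ⟨τ, hτ⟩
  have h3 := ξ₃_eq ⟨τ, hτ⟩
  have h4 := ξ₄_eq ⟨τ, hτ⟩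
  simp only at h2 h3 h4
  rw [h₀, h2, h3, h4]
  ring

lemma h₁_eq {τ : ℂ} (hτ : 0 < τ.im) : h₁ τ = θ₂ τ ^ 4 / 2 := by
  have h3 := ξ₃_eq ⟨τ, hτ⟩
  have h4 := ξ₄_eq ⟨τ, hτ⟩
  have hJ := θ₃_pow_four ⟨τ, hτ⟩
  simp only at h3 h4 hJ
  rw [h₁, h3, h4, hJ]
  ring

lemma Dq_inv_η_pow_four_mul_h₀ (z : ℍ) : Dq (fun t => (η t ^ 4)⁻¹ * h₀ t) z =
    (η z ^ 4)⁻¹ * ((θ₂ z ^ 8 - 2 * θ₄ z ^ 4 * θ₃ z ^ 4) / 12) := by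
  refine Dq_inv_η_pow_four_mul z (u := fun t => (θ₄ t ^ 4 + θ₃ t ^ 4) / 2) ?_ ?_
  · filter_upwards [isOpen_upperHalfPlaneSet.mem_nhds z.im_pos] with w hw using h₀_eq hw
  · have h := ((hasDerivAt_pow_four z (differentiableAt_θ₄ z.im_pos)).add
      (hasDerivAt_pow_four z (differentiableAt_θ₃ z.im_pos))).div_const 2
    rw [serreDerivative_θ₃_pow_four, serreDerivative_θ₄_pow_four] at h
    convert! h using 1
    rw [θ₃_pow_four]
    ring

lemma Dq_inv_η_pow_four_mul_h₁ (z : ℍ) : Dq (fun t => (η t ^ 4)⁻¹ * h₁ t) z =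
    (η z ^ 4)⁻¹ * (θ₂ z ^ 4 * (θ₄ z ^ 4 + θ₃ z ^ 4) / 12) := by
  refine Dq_inv_η_pow_four_mul z (u := fun t => θ₂ t ^ 4 / 2) ?_ ?_
  · filter_upwards [isOpen_upperHalfPlaneSet.mem_nhds z.im_pos] with w hw using h₁_eq hw
  · have h := (hasDerivAt_pow_four z (differentiableAt_θ₂ z.im_pos)).div_const 2
    rw [serreDerivative_θ₂_pow_four] at h
    convert! h using 1
    ring

lemma E4_eq (z : ℍ) : E4 z = ((θ₂ z ^ 4) ^ 2 + (θ₄ z ^ 4) ^ 2 + (θ₃ z ^ 4) ^ 2) / 2 := by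
  have h := congrFun two_mul_E₄ z
  simp only [Pi.smul_apply, smul_eq_mul, Pi.add_apply, Pi.mul_apply, fourthPowerθ₂, fourthPowerθ₃,
    fourthPowerθ₄] at h
  rw [E4_eq_E₄]
  linear_combination h / 2

lemma E6_eq (z : ℍ) : E6 z =
    (θ₄ z ^ 4 + θ₃ z ^ 4) * (θ₃ z ^ 4 + θ₂ z ^ 4) * (θ₄ z ^ 4 - θ₂ z ^ 4) / 2 := by
  have h := congrFun two_mul_E₆ z
  simp only [Pi.smul_apply, smul_eq_mul, Pi.add_apply, Pi.sub_apply, Pi.mul_apply, fourthPowerθ₂,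
    fourthPowerθ₃, fourthPowerθ₄] at h
  rw [E6_eq_E₆]
  linear_combination h / 2

lemma η_pow (z : ℍ) : 256 * η z ^ 24 = (θ₂ z ^ 4 * θ₄ z ^ 4 * θ₃ z ^ 4) ^ 2 := by
  rw [η_eq_eta]
  exact eta_pow_eq_fourthPower z

end Characters

end ThetaConstant

open Matrix

/-- The duality `(CK)ᵀ M (CK) = diag(48,16)` for the matrix of characters `K`, with
`C = diag(1/6,1)` and `M` the matrix built from `E₄`, `E₆` and `η`. -/
theorem character_matrix_duality (τ : ℂ) (hτ : 0 < τ.im) :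
    ((!![(1:ℂ)/6, 0; 0, 1]) *
        (!![(η τ ^ 4)⁻¹ * h₀ τ, (η τ ^ 4)⁻¹ * h₁ τ;
            (η τ ^ 4)⁻¹ * Dq (fun t => (η t ^ 4)⁻¹ * h₀ t) τ,
            (η τ ^ 4)⁻¹ * Dq (fun t => (η t ^ 4)⁻¹ * h₁ t) τ]))ᵀ *
      (!![(η τ ^ 16)⁻¹ * E4 τ ^ 2, (η τ ^ 12)⁻¹ * E6 τ;
          (η τ ^ 12)⁻¹ * E6 τ, (η τ ^ 8)⁻¹ * E4 τ]) *
      ((!![(1:ℂ)/6, 0; 0, 1]) *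
        (!![(η τ ^ 4)⁻¹ * h₀ τ, (η τ ^ 4)⁻¹ * h₁ τ;
            (η τ ^ 4)⁻¹ * Dq (fun t => (η t ^ 4)⁻¹ * h₀ t) τ,
            (η τ ^ 4)⁻¹ * Dq (fun t => (η t ^ 4)⁻¹ * h₁ t) τ])) =
    !![(48 : ℂ), 0; 0, 16] := by
  lift τ to UpperHalfPlane using hτ
  have hη := ThetaConstant.η_pow τ
  have hη0 := ThetaConstant.η_ne_zero τ
  have h16 : (η τ ^ 16)⁻¹ = (η τ ^ 4)⁻¹ ^ 4 := by rw [inv_pow, ← pow_mul]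
  have h12 : (η τ ^ 12)⁻¹ = (η τ ^ 4)⁻¹ ^ 3 := by rw [inv_pow, ← pow_mul]
  have h8 : (η τ ^ 8)⁻¹ = (η τ ^ 4)⁻¹ ^ 2 := by rw [inv_pow, ← pow_mul]
  have hu : (η τ ^ 4)⁻¹ ^ 6 * (θ₂ τ ^ 4 * θ₄ τ ^ 4 * θ₃ τ ^ 4) ^ 2 = 256 := by
    rw [← hη]
    field_simp
  have h28 : θ₂ τ ^ 8 = (θ₂ τ ^ 4) ^ 2 := by ring
  rw [ThetaConstant.Dq_inv_η_pow_four_mul_h₀, ThetaConstant.Dq_inv_η_pow_four_mul_h₁,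
    ThetaConstant.h₀_eq τ.im_pos, ThetaConstant.h₁_eq τ.im_pos, ThetaConstant.E4_eq,
    ThetaConstant.E6_eq, h16, h12, h8, h28, ThetaConstant.θ₃_pow_four]
  rw [ThetaConstant.θ₃_pow_four] at hu
  generalize (η τ ^ 4)⁻¹ = u at *
  generalize θ₂ τ ^ 4 = a at *
  generalize θ₄ τ ^ 4 = b at *
  ext i j
  fin_cases i <;> fin_cases j <;>
    simp only [Matrix.mul_apply, Fin.sum_univ_two, Matrix.transpose_apply, Matrix.of_apply,
      Matrix.cons_val', Matrix.cons_val_zero, Matrix.cons_val_one, Matrix.cons_val_fin_one,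
      Fin.zero_eta, Fin.mk_one, Fin.isValue]
  · linear_combination (48 / 256) * hu
  · ring
  · ring
  · linear_combination (16 / 256) * hu
end

section
/- Let k ∈ (1/2)ℤ with 0 < k < 4 and set α := (k+1)/6. Then there exist unique holomorphic functions g₁ and g₂ on the open unit disc {q ∈ ℂ : |q| < 1} with g₁(0) = g₂(0) = 1 such that the functions f₁(τ) := g₁(e^{2πiτ}) and f₂(τ) := e^{2πiατ}·g₂(e^{2πiτ}) on ℍ both satisfy the Kaneko–Zagier equation of weight k, ∂_{k+2}∂_k f = (k/12)·((k+2)/12)·E4·f. Moreover, the first Taylor coefficients of g₁ and g₂ at 0 are g₁'(0) = 12k(k+1)/(5−k) and g₂'(0) = 4(k+1)(2k−1)/(k+7). -/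
open Complex

/-- `f` satisfies the Kaneko–Zagier equation of weight `k` on the upper half-plane:
`∂_{k+2}∂_k f = (k/12)((k+2)/12) E₄ f`. -/
def SatisfiesKZ (k : ℝ) (f : ℂ → ℂ) : Prop :=
  ∀ τ : ℂ, 0 < τ.im →
    partialD ((k : ℂ) + 2) (partialD (k : ℂ) f) τ =
      ((k : ℂ) / 12) * (((k : ℂ) + 2) / 12) * E4 τ * f τ



namespace KanekoZagier

open PowerSeries Finset Filter Topology

/-- The power series `a` converges absolutely on the open unit disc. -/
def ConvOnDisc (a : ℂ⟦X⟧) : Prop :=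
  ∀ r : ℝ, 0 ≤ r → r < 1 → Summable fun n => ‖coeff n a‖ * r ^ n

/-- The sum of the power series `a` at `q`. -/
noncomputable def evalAt (a : ℂ⟦X⟧) (q : ℂ) : ℂ := ∑' n, coeff n a * q ^ n

/-- The operator `q ^ (-s) ∘ (q d/dq) ∘ q ^ s` on power series. -/
noncomputable def theta (s : ℂ) (a : ℂ⟦X⟧) : ℂ⟦X⟧ :=
  PowerSeries.mk fun n => ((n : ℂ) + s) * coeff n a

@[simp] lemma coeff_theta (s : ℂ) (a : ℂ⟦X⟧) (n : ℕ) :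
    coeff n (theta s a) = ((n : ℂ) + s) * coeff n a := coeff_mk _ _

lemma theta_eq (s : ℂ) (a : ℂ⟦X⟧) : theta s a = theta 0 a + C s * a := by
  ext n; simp [coeff_C_mul]; ring

lemma theta_add (s : ℂ) (a b : ℂ⟦X⟧) : theta s (a + b) = theta s a + theta s b := by
  ext n; simp; ring

lemma theta_sub (s : ℂ) (a b : ℂ⟦X⟧) : theta s (a - b) = theta s a - theta s b := by
  ext n; simp; ring

lemma theta_zero_C (c : ℂ) : theta 0 (C c) = 0 := by
  ext n
  rcases eq_or_ne n 0 with rfl | hn <;> simp [coeff_C, *]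

lemma theta_mul (s : ℂ) (a b : ℂ⟦X⟧) : theta s (a * b) = theta 0 a * b + a * theta s b := by
  ext n
  simp only [coeff_theta, coeff_mul, map_add, mul_sum, ← sum_add_distrib]
  refine sum_congr rfl fun p hp => ?_
  rw [← mem_antidiagonal.mp hp]
  push_cast
  ring

namespace ConvOnDisc

variable {a b : ℂ⟦X⟧} {q : ℂ}

lemma summable_norm (ha : ConvOnDisc a) (hq : ‖q‖ < 1) :
    Summable fun n => ‖coeff n a * q ^ n‖ := by
  simpa using ha ‖q‖ (norm_nonneg q) hq

lemma of_summable (h : ∀ q : ℂ, ‖q‖ < 1 → Summable fun n => ‖coeff n a * q ^ n‖) :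
    ConvOnDisc a := by
  intro r h0 h1
  have hr : ‖(r : ℂ)‖ = r := by simp [abs_of_nonneg h0]
  simpa [abs_of_nonneg h0] using h r (by rwa [hr])

lemma add (ha : ConvOnDisc a) (hb : ConvOnDisc b) : ConvOnDisc (a + b) := by
  refine of_summable fun q hq => ?_
  simp only [map_add, add_mul]
  exact ((ha.summable_norm hq).of_norm.add (hb.summable_norm hq).of_norm).norm

lemma sub (ha : ConvOnDisc a) (hb : ConvOnDisc b) : ConvOnDisc (a - b) := by
  refine of_summable fun q hq => ?_
  simp only [map_sub, sub_mul]
  exact ((ha.summable_norm hq).of_norm.sub (hb.summable_norm hq).of_norm).norm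

lemma const_mul (c : ℂ) (ha : ConvOnDisc a) : ConvOnDisc (C c * a) := by
  refine of_summable fun q hq => ?_
  simp only [coeff_C_mul, mul_assoc, norm_mul c]
  exact (ha.summable_norm hq).mul_left ‖c‖

lemma one : ConvOnDisc 1 := by
  refine of_summable fun q _ => summable_of_ne_finset_zero (s := {0}) fun n hn => ?_
  simp [coeff_one, show n ≠ 0 by simpa using hn]

lemma const (c : ℂ) : ConvOnDisc (C c) := by simpa using one.const_mul c

lemma coeff_mul_mul_pow (a b : ℂ⟦X⟧) (q : ℂ) (n : ℕ) :
    coeff n (a * b) * q ^ n =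
      ∑ p ∈ antidiagonal n, (coeff p.1 a * q ^ p.1) * (coeff p.2 b * q ^ p.2) := by
  rw [coeff_mul, sum_mul]
  refine sum_congr rfl fun p hp => ?_
  rw [← mem_antidiagonal.mp hp, pow_add]
  ring

lemma mul (ha : ConvOnDisc a) (hb : ConvOnDisc b) : ConvOnDisc (a * b) := by
  refine of_summable fun q hq => ?_
  simp only [coeff_mul_mul_pow]
  exact summable_norm_sum_mul_antidiagonal_of_summable_norm
    (f := fun n => coeff n a * q ^ n) (g := fun n => coeff n b * q ^ n)
    (ha.summable_norm hq) (hb.summable_norm hq)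

lemma of_norm_le (h : ∀ r : ℝ, 0 < r → r < 1 →
    ∃ K : ℝ, ∀ n : ℕ, ‖coeff n a‖ * r ^ n ≤ K * ((n : ℝ) + 1)) : ConvOnDisc a := by
  intro r h0 h1
  obtain ⟨ρ, hρ, hρ1⟩ := exists_between h1
  have hρ0 : 0 < ρ := h0.trans_lt hρ
  obtain ⟨K, hK⟩ := h ρ hρ0 hρ1
  have ht : ‖r / ρ‖ < 1 := by
    rw [Real.norm_of_nonneg (by positivity)]
    exact (div_lt_one hρ0).mpr hρ
  have hs : Summable fun n : ℕ => K * ((n : ℝ) ^ 1 * (r / ρ) ^ n + (r / ρ) ^ n) :=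
    ((summable_pow_mul_geometric_of_norm_lt_one 1 ht).add
      (summable_geometric_of_norm_lt_one ht)).mul_left K
  refine Summable.of_nonneg_of_le (fun n => by positivity) (fun n => ?_) hs
  calc ‖coeff n a‖ * r ^ n = ‖coeff n a‖ * ρ ^ n * (r / ρ) ^ n := by
        rw [mul_assoc, ← mul_pow, mul_div_cancel₀ _ hρ0.ne']
    _ ≤ K * ((n : ℝ) + 1) * (r / ρ) ^ n :=
        mul_le_mul_of_nonneg_right (hK n) (by positivity)
    _ = _ := by ring

lemma theta (s : ℂ) (ha : ConvOnDisc a) : ConvOnDisc (theta s a) := by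
  refine of_norm_le fun r h0 h1 => ?_
  have hsum := ha r h0.le h1
  refine ⟨(1 + ‖s‖) * ∑' n, ‖coeff n a‖ * r ^ n, fun n => ?_⟩
  have h2 : ‖coeff n a‖ * r ^ n ≤ ∑' n, ‖coeff n a‖ * r ^ n :=
    hsum.le_tsum n fun _ _ => by positivity
  have h3 : ‖(n : ℂ) + s‖ ≤ (1 + ‖s‖) * ((n : ℝ) + 1) := by
    have := norm_add_le (n : ℂ) s
    rw [Complex.norm_natCast] at this
    nlinarith [norm_nonneg s, (Nat.cast_nonneg n : (0 : ℝ) ≤ n)]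
  rw [coeff_theta, norm_mul, mul_assoc]
  calc _ ≤ ((1 + ‖s‖) * ((n : ℝ) + 1)) * ∑' n, ‖coeff n a‖ * r ^ n := by gcongr
    _ = _ := by ring

lemma evalAt_add (ha : ConvOnDisc a) (hb : ConvOnDisc b) (hq : ‖q‖ < 1) :
    evalAt (a + b) q = evalAt a q + evalAt b q := by
  simp only [evalAt, map_add, add_mul]
  exact (ha.summable_norm hq).of_norm.tsum_add (hb.summable_norm hq).of_norm

lemma evalAt_sub (ha : ConvOnDisc a) (hb : ConvOnDisc b) (hq : ‖q‖ < 1) :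
    evalAt (a - b) q = evalAt a q - evalAt b q := by
  simp only [evalAt, map_sub, sub_mul]
  exact (ha.summable_norm hq).of_norm.tsum_sub (hb.summable_norm hq).of_norm

lemma evalAt_mul (ha : ConvOnDisc a) (hb : ConvOnDisc b) (hq : ‖q‖ < 1) :
    evalAt (a * b) q = evalAt a q * evalAt b q := by
  simp only [evalAt, coeff_mul_mul_pow]
  exact (tsum_mul_tsum_eq_tsum_sum_antidiagonal_of_summable_norm (ha.summable_norm hq)
    (hb.summable_norm hq)).symm

end ConvOnDisc

lemma evalAt_zero_right (a : ℂ⟦X⟧) : evalAt a 0 = coeff 0 a := by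
  rw [evalAt, tsum_eq_single 0 fun n hn => by simp [hn]]
  simp

lemma evalAt_C (c q : ℂ) : evalAt (C c) q = c := by
  rw [evalAt, tsum_eq_single 0 fun n hn => by simp [coeff_C, hn]]
  simp

lemma evalAt_C_mul (c : ℂ) (a : ℂ⟦X⟧) (q : ℂ) : evalAt (C c * a) q = c * evalAt a q := by
  simp only [evalAt, coeff_C_mul, mul_assoc, tsum_mul_left]

namespace ConvOnDisc

variable {a b : ℂ⟦X⟧} {q : ℂ}

lemma hasFPowerSeriesOnBall (ha : ConvOnDisc a) :
    HasFPowerSeriesOnBall (evalAt a)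
      (FormalMultilinearSeries.ofScalars ℂ fun n => coeff n a) 0 1 where
  r_le := by
    refine ENNReal.le_of_forall_nnreal_lt fun r hr => ?_
    refine FormalMultilinearSeries.le_radius_of_summable_norm _ ?_
    simp only [FormalMultilinearSeries.ofScalars_norm]
    exact ha r r.2 (by exact_mod_cast hr)
  r_pos := one_pos
  hasSum := fun {y} hy => by
    have hy : ‖y‖ < 1 := by
      rw [← ENNReal.ofReal_one, Metric.eball_ofReal] at hy
      simpa using hy
    simp only [FormalMultilinearSeries.ofScalars_apply_eq, smul_eq_mul, zero_add]
    exact (ha.summable_norm hy).of_norm.hasSum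

lemma differentiableOn (ha : ConvOnDisc a) :
    DifferentiableOn ℂ (evalAt a) (Metric.ball 0 1) := by
  have := ha.hasFPowerSeriesOnBall.differentiableOn
  rwa [← ENNReal.ofReal_one, Metric.eball_ofReal] at this

lemma differentiableAt (ha : ConvOnDisc a) (hq : ‖q‖ < 1) : DifferentiableAt ℂ (evalAt a) q :=
  ha.differentiableOn.differentiableAt (Metric.isOpen_ball.mem_nhds (by simpa using hq))

lemma deriv_zero (ha : ConvOnDisc a) : deriv (evalAt a) 0 = coeff 1 a := by
  rw [ha.hasFPowerSeriesOnBall.hasFPowerSeriesAt.deriv,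
    FormalMultilinearSeries.ofScalars_apply_eq]
  simp

lemma eq_zero_of_evalAt (ha : ConvOnDisc a)
    (h : ∀ q : ℂ, q ≠ 0 → ‖q‖ < 1 → evalAt a q = 0) : a = 0 := by
  have hp := ha.hasFPowerSeriesOnBall.hasFPowerSeriesAt
  have hev : ∀ᶠ q in 𝓝[≠] (0 : ℂ), evalAt a q = 0 := by
    filter_upwards [self_mem_nhdsWithin,
      nhdsWithin_le_nhds (Metric.ball_mem_nhds (0 : ℂ) one_pos)] with q h0 h1
    exact h q h0 (by simpa using h1)
  have h0 := hp.analyticAt.frequently_zero_iff_eventually_zero.mp hev.frequently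
  have := (hp.congr (g := 0) h0).eq_zero
  ext n
  have hn := congrArg (fun p => FormalMultilinearSeries.coeff p n) this
  rw [FormalMultilinearSeries.coeff_ofScalars] at hn
  rw [hn]
  rfl

lemma mul_deriv_evalAt (ha : ConvOnDisc a) (hq : ‖q‖ < 1) :
    q * deriv (evalAt a) q = evalAt (KanekoZagier.theta 0 a) q := by
  obtain ⟨ρ, hρ, hρ1⟩ := exists_between hq
  have h := Complex.hasSum_deriv_of_summable_norm (U := Metric.ball (0 : ℂ) ρ) (z := q)
    (F := fun n w => coeff n a * w ^ n) (ha ρ ((norm_nonneg q).trans hρ.le) hρ1)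
    (fun n => by fun_prop) Metric.isOpen_ball
    (fun n w hw => by
      rw [norm_mul, norm_pow]
      gcongr
      exact (by simpa using hw : ‖w‖ < ρ).le) (by simpa using hρ)
  refine (h.mul_left q).tsum_eq.symm.trans (tsum_congr fun n => ?_)
  rcases n with _ | n
  · simp
  · rw [deriv_const_mul_field, deriv_pow_field, coeff_theta, Nat.add_sub_cancel, pow_succ]
    ring

lemma evalAt_theta (s : ℂ) (ha : ConvOnDisc a) (hq : ‖q‖ < 1) :
    evalAt (KanekoZagier.theta s a) q = q * deriv (evalAt a) q + s * evalAt a q := by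
  rw [theta_eq, evalAt_add (ha.theta 0) (ha.const_mul s) hq, evalAt_C_mul,
    ha.mul_deriv_evalAt hq]

end ConvOnDisc

/-- A holomorphic function on the open unit disc is the sum of a power series. -/
lemma exists_evalAt_eq {g : ℂ → ℂ} (hg : DifferentiableOn ℂ g (Metric.ball 0 1)) :
    ∃ a, ConvOnDisc a ∧ Set.EqOn g (evalAt a) (Metric.ball 0 1) := by
  have h : ∀ q ∈ Metric.ball (0 : ℂ) 1,
      HasSum (fun n => ((n.factorial : ℂ)⁻¹ * iteratedDeriv n g 0) * q ^ n) (g q) := by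
    intro q hq
    have h := Complex.hasSum_taylorSeries_on_ball hg hq
    simp only [sub_zero, smul_eq_mul] at h
    rwa [show (fun n : ℕ => (n.factorial : ℂ)⁻¹ * iteratedDeriv n g 0 * q ^ n) =
      fun n => (n.factorial : ℂ)⁻¹ * (q ^ n * iteratedDeriv n g 0) from funext fun n => by ring]
  refine ⟨PowerSeries.mk fun n => (n.factorial : ℂ)⁻¹ * iteratedDeriv n g 0, ?_, ?_⟩
  · refine ConvOnDisc.of_summable fun q hq => ?_
    simp only [coeff_mk]
    exact (h q (by simpa using hq)).summable.norm
  · intro q hq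
    simp only [evalAt]
    rw [← (h q hq).tsum_eq]
    exact tsum_congr fun n => by rw [coeff_mk]

/-- The operator `θ² + B θ + Γ` on power series, where `θ = q d/dq`. -/
noncomputable def frobOp (B Γ a : ℂ⟦X⟧) : ℂ⟦X⟧ :=
  theta 0 (theta 0 a) + B * theta 0 a + Γ * a

lemma ConvOnDisc.frobOp {B Γ a : ℂ⟦X⟧} (hB : ConvOnDisc B) (hΓ : ConvOnDisc Γ)
    (ha : ConvOnDisc a) : ConvOnDisc (frobOp B Γ a) :=
  (((ha.theta 0).theta 0).add (hB.mul (ha.theta 0))).add (hΓ.mul ha)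

lemma coeff_frobOp {B Γ : ℂ⟦X⟧} (hΓ : coeff 0 Γ = 0) (a : ℂ⟦X⟧) (n : ℕ) :
    coeff n (frobOp B Γ a) = n * (n + coeff 0 B) * coeff n a +
      ∑ i ∈ range n, (coeff (n - i) B * i + coeff (n - i) Γ) * coeff i a := by
  simp only [frobOp, map_add]
  rw [mul_comm B, mul_comm Γ, coeff_mul, coeff_mul, Nat.sum_antidiagonal_eq_sum_range_succ_mk,
    Nat.sum_antidiagonal_eq_sum_range_succ_mk, sum_range_succ, sum_range_succ]
  simp only [coeff_theta, Nat.sub_self, hΓ, add_zero, mul_zero, add_mul, sum_add_distrib]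
  rw [sum_congr rfl fun (i : ℕ) _ => show (i : ℂ) * coeff i a * coeff (n - i) B =
      coeff (n - i) B * i * coeff i a by ring,
    sum_congr rfl fun (i : ℕ) _ => mul_comm (coeff i a) (coeff (n - i) Γ)]
  ring

/-- The coefficients of the normalized power series solution of `(θ² + B θ + Γ) a = 0`. -/
noncomputable def frobCoeff (B Γ : ℂ⟦X⟧) : ℕ → ℂ
  | 0 => 1
  | n + 1 => -(∑ i : Fin (n + 1),
      (coeff (n + 1 - i) B * (i : ℕ) + coeff (n + 1 - i) Γ) * frobCoeff B Γ i) /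
        (((n + 1 : ℕ) : ℂ) * (((n + 1 : ℕ) : ℂ) + coeff 0 B))
  decreasing_by exact i.2

section Frobenius

variable {B Γ a b : ℂ⟦X⟧}

lemma frobOp_mk_frobCoeff (hΓ : coeff 0 Γ = 0) (hB : ∀ n : ℕ, n ≠ 0 → (n : ℂ) + coeff 0 B ≠ 0) :
    frobOp B Γ (PowerSeries.mk (frobCoeff B Γ)) = 0 := by
  ext n
  rw [coeff_frobOp hΓ, map_zero]
  simp only [coeff_mk]
  rcases n with _ | n
  · simp
  · rw [frobCoeff, Fin.sum_univ_eq_sum_range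
      (fun i => (coeff (n + 1 - i) B * (i : ℂ) + coeff (n + 1 - i) Γ) * frobCoeff B Γ i) (n + 1),
      mul_div_cancel₀ _ (mul_ne_zero (Nat.cast_ne_zero.mpr n.succ_ne_zero)
        (hB _ n.succ_ne_zero)), neg_add_cancel]

lemma frobOp_unique (hΓ : coeff 0 Γ = 0) (hB : ∀ n : ℕ, n ≠ 0 → (n : ℂ) + coeff 0 B ≠ 0)
    (ha : frobOp B Γ a = 0) (hb : frobOp B Γ b = 0) (h0 : coeff 0 a = coeff 0 b) : a = b := by
  ext n
  induction n using Nat.strong_induction_on with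
  | _ n ih =>
    rcases eq_or_ne n 0 with rfl | hn
    · exact h0
    have h := (congrArg (coeff n) ha).trans (congrArg (coeff n) hb).symm
    rw [coeff_frobOp hΓ, coeff_frobOp hΓ,
      sum_congr rfl fun i hi => by rw [ih i (mem_range.mp hi)]] at h
    exact mul_left_cancel₀ (mul_ne_zero (Nat.cast_ne_zero.mpr hn) (hB n hn))
      (add_right_cancel h)

lemma coeff_one_of_frobOp (hΓ : coeff 0 Γ = 0) (ha : frobOp B Γ a = 0) (h0 : coeff 0 a = 1) :
    (1 + coeff 0 B) * coeff 1 a = -coeff 1 Γ := by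
  have h := congrArg (coeff 1) ha
  rw [coeff_frobOp hΓ] at h
  simp [h0, -coeff_zero_eq_constantCoeff] at h
  linear_combination h

/-- Power series solutions at a regular singular point converge. -/
lemma convOnDisc_of_frobOp (hBc : ConvOnDisc B) (hΓc : ConvOnDisc Γ) (hΓ : coeff 0 Γ = 0)
    (ha : frobOp B Γ a = 0) : ConvOnDisc a := by
  refine ConvOnDisc.of_norm_le fun r h0 h1 => ?_
  set w : ℕ → ℝ := fun j => (‖coeff j B‖ + ‖coeff j Γ‖) * r ^ j with hw
  have hw0 : ∀ j, 0 ≤ w j := fun j => by positivity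
  have hws : Summable w := by
    simpa only [hw, add_mul] using (hBc r h0.le h1).add (hΓc r h0.le h1)
  obtain ⟨N, hN⟩ := exists_nat_ge (‖coeff 0 B‖ + ∑' j, w j)
  set K := ∑ i ∈ range (N + 1), ‖coeff i a‖ * r ^ i with hK
  have hK0 : 0 ≤ K := sum_nonneg fun i _ => by positivity
  have key : ∀ n, ‖coeff n a‖ * r ^ n ≤ K := by
    intro n
    induction n using Nat.strong_induction_on with
    | _ n ih =>
      rcases lt_or_ge n (N + 1) with hn | hn
      · exact single_le_sum (f := fun i => ‖coeff i a‖ * r ^ i) (fun i _ => by positivity)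
          (mem_range.mpr hn)
      have hn0 : 0 < (n : ℝ) := by exact_mod_cast (by omega : 0 < n)
      have hrec : (n : ℂ) * (n + coeff 0 B) * coeff n a =
          -∑ i ∈ range n, (coeff (n - i) B * i + coeff (n - i) Γ) * coeff i a := by
        have h := congrArg (coeff n) ha
        rw [coeff_frobOp hΓ, map_zero] at h
        exact eq_neg_of_add_eq_zero_left h
      have hsum : ∑ i ∈ range n, w (n - i) ≤ ∑' j, w j := by
        rw [← sum_range_reflect]
        calc _ = ∑ i ∈ range n, w (i + 1) := by
              refine sum_congr rfl fun i hi => ?_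
              have := mem_range.mp hi
              congr 1; omega
          _ ≤ ∑ i ∈ range (n + 1), w i := by
              rw [sum_range_succ' w n]; linarith [hw0 0]
          _ ≤ _ := hws.sum_le_tsum _ fun i _ => hw0 i
      have hden : ∑' j, w j < ‖(n : ℂ) + coeff 0 B‖ := by
        have h2 := norm_sub_le ((n : ℂ) + coeff 0 B) (coeff 0 B)
        rw [add_sub_cancel_right, Complex.norm_natCast] at h2
        have : (N : ℝ) + 1 ≤ n := by exact_mod_cast hn
        linarith
      have hw1 : 0 ≤ ∑' j, w j := tsum_nonneg hw0
      have hbound : (n : ℝ) * ‖(n : ℂ) + coeff 0 B‖ * (‖coeff n a‖ * r ^ n) ≤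
          n * (∑' j, w j) * K := by
        calc _ = ‖(n : ℂ) * (n + coeff 0 B) * coeff n a‖ * r ^ n := by
              rw [norm_mul, norm_mul, Complex.norm_natCast]; ring
          _ ≤ (∑ i ∈ range n,
                ‖(coeff (n - i) B * i + coeff (n - i) Γ) * coeff i a‖) * r ^ n := by
              rw [hrec, norm_neg]
              gcongr
              exact norm_sum_le _ _
          _ ≤ ∑ i ∈ range n, n * w (n - i) * K := by
              rw [sum_mul]
              refine sum_le_sum fun i hi => ?_
              have hi := mem_range.mp hi
              have hi1 : (i : ℝ) ≤ n := by exact_mod_cast hi.le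
              have hn1 : (1 : ℝ) ≤ n := by exact_mod_cast (by omega : 1 ≤ n)
              have hc : ‖coeff (n - i) B * i + coeff (n - i) Γ‖ ≤
                  n * (‖coeff (n - i) B‖ + ‖coeff (n - i) Γ‖) := by
                refine (norm_add_le _ _).trans ?_
                rw [norm_mul, Complex.norm_natCast]
                nlinarith [norm_nonneg (coeff (n - i) B), norm_nonneg (coeff (n - i) Γ)]
              calc _ = ‖coeff (n - i) B * i + coeff (n - i) Γ‖ * r ^ (n - i) *
                    (‖coeff i a‖ * r ^ i) := by
                    rw [norm_mul]
                    rw [← pow_sub_mul_pow r hi.le]; ring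
                _ ≤ n * (‖coeff (n - i) B‖ + ‖coeff (n - i) Γ‖) * r ^ (n - i) * K := by
                    gcongr
                    exact ih i hi
                _ = _ := by simp only [hw]; ring
          _ = n * (∑ i ∈ range n, w (n - i)) * K := by rw [← sum_mul, mul_sum (range n)]
          _ ≤ _ := by gcongr
      have hbound' : ‖(n : ℂ) + coeff 0 B‖ * (‖coeff n a‖ * r ^ n) ≤
          ‖(n : ℂ) + coeff 0 B‖ * K := by
        refine le_of_mul_le_mul_left ?_ hn0
        rw [← mul_assoc]
        refine hbound.trans ?_
        rw [mul_assoc]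
        gcongr
      exact le_of_mul_le_mul_left hbound' (hw1.trans_lt hden)
  refine ⟨K, fun n => (key n).trans ?_⟩
  nlinarith [(Nat.cast_nonneg n : (0 : ℝ) ≤ n)]

end Frobenius

/-- The generating series of `σ_k`. -/
noncomputable def sigmaSeries (k : ℕ) : ℂ⟦X⟧ := PowerSeries.mk fun n => (sigma' k n : ℂ)

/-- The `q`-expansion of `E₂`. -/
noncomputable def e₂ : ℂ⟦X⟧ := 1 - C 24 * sigmaSeries 1

/-- The `q`-expansion of `E₄`. -/
noncomputable def e₄ : ℂ⟦X⟧ := 1 + C 240 * sigmaSeries 3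

lemma sigma'_zero (k : ℕ) : sigma' k 0 = 0 := by simp [sigma']

lemma sigma'_one (k : ℕ) : sigma' k 1 = 1 := by simp [sigma']

lemma sigma'_le (k n : ℕ) : sigma' k n ≤ n ^ (k + 1) := by
  calc sigma' k n ≤ ∑ _d ∈ n.divisors, n ^ k :=
        sum_le_sum fun d hd => Nat.pow_le_pow_left (Nat.divisor_le hd) k
    _ = n.divisors.card * n ^ k := by simp
    _ ≤ n * n ^ k := Nat.mul_le_mul_right _ (Nat.card_divisors_le_self n)
    _ = _ := by ring

lemma convOnDisc_sigmaSeries (k : ℕ) : ConvOnDisc (sigmaSeries k) := by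
  intro r h0 h1
  refine Summable.of_nonneg_of_le (fun n => by positivity) (fun n => ?_)
    (summable_pow_mul_geometric_of_norm_lt_one (k + 1)
      (show ‖r‖ < 1 by rwa [Real.norm_of_nonneg h0]))
  rw [sigmaSeries, coeff_mk, Complex.norm_natCast]
  gcongr
  exact_mod_cast sigma'_le k n

lemma convOnDisc_e₂ : ConvOnDisc e₂ := ConvOnDisc.one.sub ((convOnDisc_sigmaSeries 1).const_mul _)

lemma convOnDisc_e₄ : ConvOnDisc e₄ := ConvOnDisc.one.add ((convOnDisc_sigmaSeries 3).const_mul _)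

lemma evalAt_sigmaSeries (k : ℕ) {q : ℂ} (hq : ‖q‖ < 1) :
    evalAt (sigmaSeries k) q = ∑' n : ℕ, (sigma' k (n + 1) : ℂ) * q ^ (n + 1) := by
  rw [evalAt, ((convOnDisc_sigmaSeries k).summable_norm hq).of_norm.tsum_eq_zero_add]
  simp only [sigmaSeries, coeff_mk, sigma'_zero, Nat.cast_zero, zero_mul, zero_add]

lemma norm_qexp_lt_one {τ : ℂ} (hτ : 0 < τ.im) : ‖qexp τ‖ < 1 := by
  rw [qexp, Complex.norm_exp, Real.exp_lt_one_iff]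
  simp
  positivity

lemma hasDerivAt_qexp (τ : ℂ) : HasDerivAt qexp (2 * ↑Real.pi * Complex.I * qexp τ) τ := by
  unfold qexp
  have h := (hasDerivAt_const_mul (x := τ) (2 * ↑Real.pi * Complex.I)).cexp
  rwa [mul_comm (Complex.exp _)] at h

lemma hasDerivAt_qpow (s : ℝ) (τ : ℂ) :
    HasDerivAt (qpow s) (2 * ↑Real.pi * Complex.I * s * qpow s τ) τ := by
  unfold qpow
  have h := (hasDerivAt_const_mul (x := τ) (2 * ↑Real.pi * Complex.I * ↑s)).cexp
  rwa [mul_comm (Complex.exp _)] at h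

lemma exists_qexp_eq {q : ℂ} (h0 : q ≠ 0) (h1 : ‖q‖ < 1) : ∃ τ : ℂ, 0 < τ.im ∧ qexp τ = q := by
  refine ⟨Function.Periodic.invQParam 1 q, ?_, ?_⟩
  · rw [Function.Periodic.im_invQParam]
    have := Real.log_neg (norm_pos_iff.mpr h0) h1
    have := Real.pi_pos
    rw [neg_div, neg_mul, Left.neg_pos_iff]
    exact mul_neg_of_pos_of_neg (by positivity) ‹_›
  · refine Eq.trans ?_ (Function.Periodic.qParam_right_inv one_ne_zero h0)
    simp [qexp, Function.Periodic.qParam]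

lemma E2_eq_evalAt {τ : ℂ} (hτ : 0 < τ.im) : E2 τ = evalAt e₂ (qexp τ) := by
  have hq := norm_qexp_lt_one hτ
  rw [e₂, ConvOnDisc.one.evalAt_sub ((convOnDisc_sigmaSeries 1).const_mul _) hq, evalAt_C_mul,
    evalAt_sigmaSeries 1 hq, ← map_one C, evalAt_C, E2]

lemma E4_eq_evalAt {τ : ℂ} (hτ : 0 < τ.im) : E4 τ = evalAt e₄ (qexp τ) := by
  have hq := norm_qexp_lt_one hτ
  rw [e₄, ConvOnDisc.one.evalAt_add ((convOnDisc_sigmaSeries 3).const_mul _) hq, evalAt_C_mul,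
    evalAt_sigmaSeries 3 hq, ← map_one C, evalAt_C, E4]

/-- The operator on power series induced by `partialD k` on `q ^ s * a(q)`. -/
noncomputable def serreOp (k s : ℂ) (a : ℂ⟦X⟧) : ℂ⟦X⟧ := theta s a - C (k / 12) * (e₂ * a)

lemma ConvOnDisc.serreOp {a : ℂ⟦X⟧} (ha : ConvOnDisc a) (k s : ℂ) :
    ConvOnDisc (serreOp k s a) :=
  (ha.theta s).sub ((convOnDisc_e₂.mul ha).const_mul _)

lemma Dq_qpow_mul_evalAt {a : ℂ⟦X⟧} (ha : ConvOnDisc a) (s : ℝ) {τ : ℂ} (hτ : 0 < τ.im) :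
    Dq (fun τ => qpow s τ * evalAt a (qexp τ)) τ = qpow s τ * evalAt (theta s a) (qexp τ) := by
  have hq := norm_qexp_lt_one hτ
  have h := (hasDerivAt_qpow s τ).mul
    ((ha.differentiableAt hq).hasDerivAt.comp τ (hasDerivAt_qexp τ))
  have h' : deriv (fun τ => qpow s τ * evalAt a (qexp τ)) τ = _ := h.deriv
  rw [Dq, h', ha.evalAt_theta _ hq, div_eq_iff Complex.two_pi_I_ne_zero]
  simp only [Function.comp]
  ring

lemma partialD_qpow_mul_evalAt {a : ℂ⟦X⟧} (ha : ConvOnDisc a) (k : ℂ) (s : ℝ) {τ : ℂ}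
    (hτ : 0 < τ.im) :
    partialD k (fun τ => qpow s τ * evalAt a (qexp τ)) τ =
      qpow s τ * evalAt (serreOp k s a) (qexp τ) := by
  have hq := norm_qexp_lt_one hτ
  rw [partialD, Dq_qpow_mul_evalAt ha s hτ, serreOp,
    (ha.theta s).evalAt_sub ((convOnDisc_e₂.mul ha).const_mul _) hq, evalAt_C_mul,
    convOnDisc_e₂.evalAt_mul ha hq, E2_eq_evalAt hτ]
  ring

lemma partialD_congr {f g : ℂ → ℂ} (k : ℂ) (h : ∀ τ : ℂ, 0 < τ.im → f τ = g τ) {τ : ℂ}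
    (hτ : 0 < τ.im) : partialD k f τ = partialD k g τ := by
  have hev : f =ᶠ[𝓝 τ] g := by
    filter_upwards [(isOpen_lt continuous_const Complex.continuous_im).mem_nhds hτ] with z hz
    exact h z hz
  simp only [partialD, Dq, hev.deriv_eq, h τ hτ]

lemma satisfiesKZ_congr {k : ℝ} {f g : ℂ → ℂ} (h : ∀ τ : ℂ, 0 < τ.im → f τ = g τ) :
    SatisfiesKZ k f ↔ SatisfiesKZ k g := by
  refine forall₂_congr fun τ hτ => ?_
  rw [partialD_congr _ (fun z hz => partialD_congr _ h hz) hτ, h τ hτ]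

/-- The first order coefficient of the Kaneko–Zagier equation for `q ^ s * a(q)`. -/
noncomputable def kzB (k s : ℂ) : ℂ⟦X⟧ := C (2 * s) - C ((k + 1) / 6) * e₂

/-- The zeroth order coefficient of the Kaneko–Zagier equation for `q ^ s * a(q)`. -/
noncomputable def kzΓ (k s : ℂ) : ℂ⟦X⟧ :=
  C (s ^ 2) - C ((k + 1) / 6 * s) * e₂ - C (k / 12) * theta 0 e₂ +
    C (k / 12 * ((k + 2) / 12)) * (e₂ * e₂ - e₄)

lemma convOnDisc_kzB (k s : ℂ) : ConvOnDisc (kzB k s) :=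
  (ConvOnDisc.const _).sub (convOnDisc_e₂.const_mul _)

lemma convOnDisc_kzΓ (k s : ℂ) : ConvOnDisc (kzΓ k s) :=
  (((ConvOnDisc.const _).sub (convOnDisc_e₂.const_mul _)).sub
    ((convOnDisc_e₂.theta 0).const_mul _)).add
      (((convOnDisc_e₂.mul convOnDisc_e₂).sub convOnDisc_e₄).const_mul _)

lemma serreOp_serreOp_sub (k s : ℂ) (a : ℂ⟦X⟧) :
    serreOp (k + 2) s (serreOp k s a) - C (k / 12 * ((k + 2) / 12)) * (e₄ * a) =
      frobOp (kzB k s) (kzΓ k s) a := by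
  have h1 : (k + 2) / 12 = k / 12 + 1 / 6 := by ring
  have h2 : (k + 1) / 6 = k / 12 + k / 12 + 1 / 6 := by ring
  simp only [serreOp, frobOp, kzB, kzΓ, h1, h2, theta_sub, theta_zero_C, theta_mul,
    theta_eq s, theta_add, map_add, map_mul, map_pow]
  rw [show C (2 : ℂ) = 2 from map_ofNat C 2]
  ring

lemma satisfiesKZ_iff {a : ℂ⟦X⟧} (ha : ConvOnDisc a) (k s : ℝ) :
    SatisfiesKZ k (fun τ => qpow s τ * evalAt a (qexp τ)) ↔ frobOp (kzB k s) (kzΓ k s) a = 0 := by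
  have hS : ConvOnDisc (serreOp (k + 2) s (serreOp k s a)) := (ha.serreOp _ _).serreOp _ _
  have hE : ConvOnDisc (C ((k : ℂ) / 12 * ((k + 2) / 12)) * (e₄ * a)) :=
    (convOnDisc_e₄.mul ha).const_mul _
  have key : SatisfiesKZ k (fun τ => qpow s τ * evalAt a (qexp τ)) ↔
      ∀ τ : ℂ, 0 < τ.im → evalAt (frobOp (kzB k s) (kzΓ k s) a) (qexp τ) = 0 := by
    refine forall₂_congr fun τ hτ => ?_
    have hq := norm_qexp_lt_one hτ
    rw [partialD_congr _ (fun z hz => partialD_qpow_mul_evalAt ha k s hz) hτ,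
      partialD_qpow_mul_evalAt (ha.serreOp _ _) _ _ hτ, ← serreOp_serreOp_sub,
      hS.evalAt_sub hE hq, evalAt_C_mul, convOnDisc_e₄.evalAt_mul ha hq, E4_eq_evalAt hτ,
      mul_left_comm _ (qpow s τ), mul_right_inj' (show qpow s τ ≠ 0 from Complex.exp_ne_zero _),
      sub_eq_zero, mul_assoc]
  rw [key]
  refine ⟨fun h => ?_, fun h τ _ => by simp [h, evalAt]⟩
  refine ((convOnDisc_kzB _ _).frobOp (convOnDisc_kzΓ _ _) ha).eq_zero_of_evalAt
    fun q h0 h1 => ?_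
  obtain ⟨τ, hτ, rfl⟩ := exists_qexp_eq h0 h1
  exact h τ hτ

lemma coeff_zero_e₂ : coeff 0 e₂ = 1 := by
  simp [e₂, sigmaSeries, sigma'_zero, -coeff_zero_eq_constantCoeff, coeff_C_mul]

lemma coeff_zero_e₄ : coeff 0 e₄ = 1 := by
  simp [e₄, sigmaSeries, sigma'_zero, -coeff_zero_eq_constantCoeff, coeff_C_mul]

lemma coeff_one_e₂ : coeff 1 e₂ = -24 := by
  simp [e₂, sigmaSeries, sigma'_one, coeff_C_mul, coeff_one]

lemma coeff_one_e₄ : coeff 1 e₄ = 240 := by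
  simp [e₄, sigmaSeries, sigma'_one, coeff_C_mul, coeff_one]

lemma coeff_zero_kzB (k s : ℂ) : coeff 0 (kzB k s) = 2 * s - (k + 1) / 6 := by
  rw [kzB, map_sub, coeff_C_mul, coeff_zero_e₂, coeff_zero_C, mul_one]

lemma coeff_zero_kzΓ (k s : ℂ) : coeff 0 (kzΓ k s) = s * (s - (k + 1) / 6) := by
  have h := coeff_zero_e₂
  have h' := coeff_zero_e₄
  simp only [coeff_zero_eq_constantCoeff] at h h'
  simp only [kzΓ, map_add, map_sub, coeff_C_mul, coeff_theta, coeff_zero_C,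
    coeff_zero_eq_constantCoeff, map_mul, constantCoeff_C, h, h']
  push_cast
  ring

lemma coeff_one_kzΓ (k s : ℂ) : coeff 1 (kzΓ k s) = 4 * (k + 1) * s - 2 * k * (k + 1) := by
  have h := coeff_zero_e₂
  simp only [coeff_zero_eq_constantCoeff] at h
  simp only [kzΓ, map_add, map_sub, coeff_C_mul, coeff_theta, coeff_one_mul, coeff_one_e₂,
    coeff_one_e₄, h, coeff_C, one_ne_zero, if_false]
  push_cast
  ring

/-- At a root `s` of the indicial equation such that no `s + n` with `n ≥ 1` is a root, the
Kaneko–Zagier equation has a unique normalized solution `q ^ s * g(q)`. -/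
lemma exists_unique_solution (k s : ℝ) (hs : s * (s - (k + 1) / 6) = 0)
    (hs1 : -1 < 2 * s - (k + 1) / 6) :
    ∃ g : ℂ → ℂ, DifferentiableOn ℂ g (Metric.ball 0 1) ∧ g 0 = 1 ∧
      SatisfiesKZ k (fun τ => qpow s τ * g (qexp τ)) ∧
      (1 + (2 * s - (k + 1) / 6)) * deriv g 0 = 2 * k * (k + 1) - 4 * (k + 1) * s ∧
      ∀ g' : ℂ → ℂ, DifferentiableOn ℂ g' (Metric.ball 0 1) → g' 0 = 1 →
        SatisfiesKZ k (fun τ => qpow s τ * g' (qexp τ)) → Set.EqOn g' g (Metric.ball 0 1) := by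
  have hΓ : coeff 0 (kzΓ k s) = 0 := by
    rw [coeff_zero_kzΓ]; exact_mod_cast hs
  have hB : ∀ n : ℕ, n ≠ 0 → (n : ℂ) + coeff 0 (kzB k s) ≠ 0 := by
    intro n hn
    rw [coeff_zero_kzB]
    have hn1 : (1 : ℝ) ≤ n := by exact_mod_cast Nat.one_le_iff_ne_zero.mpr hn
    exact_mod_cast (by linarith : (0 : ℝ) < n + (2 * s - (k + 1) / 6)).ne'
  have hsol := frobOp_mk_frobCoeff hΓ hB
  set a : ℂ⟦X⟧ := PowerSeries.mk (frobCoeff (kzB k s) (kzΓ k s)) with ha_def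
  have ha : ConvOnDisc a :=
    convOnDisc_of_frobOp (convOnDisc_kzB _ _) (convOnDisc_kzΓ _ _) hΓ hsol
  have ha0 : coeff 0 a = 1 := by rw [ha_def, coeff_mk, frobCoeff]
  refine ⟨evalAt a, ha.differentiableOn, by rw [evalAt_zero_right, ha0],
    (satisfiesKZ_iff ha k s).mpr hsol, ?_, fun g' hg' hg0 hKZ => ?_⟩
  · have h := coeff_one_of_frobOp hΓ hsol ha0
    rw [coeff_one_kzΓ, coeff_zero_kzB, ← ha.deriv_zero] at h
    rw [h]; ring
  · obtain ⟨b, hb, hgb⟩ := exists_evalAt_eq hg'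
    have hKZb : SatisfiesKZ k (fun τ => qpow s τ * evalAt b (qexp τ)) :=
      (satisfiesKZ_congr fun τ hτ => by
        rw [hgb (by simpa using norm_qexp_lt_one hτ)]).mp hKZ
    have hb0 : coeff 0 b = 1 := by
      rw [← evalAt_zero_right, ← hgb (Metric.mem_ball_self one_pos), hg0]
    rwa [← frobOp_unique hΓ hB ((satisfiesKZ_iff hb k s).mp hKZb) hsol (hb0.trans ha0.symm)]

end KanekoZagier

/-- Existence, uniqueness and first Taylor coefficients of the two normalized solutions
`f₁ = g₁(q)` and `f₂ = q^α g₂(q)`, `α = (k+1)/6`, of the Kaneko–Zagier equation of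
weight `k` for half-integral `0 < k < 4`. -/
theorem KZ_solutions_exist_unique (k : ℝ) (hhalf : ∃ m : ℤ, k = m / 2)
    (hk0 : 0 < k) (hk4 : k < 4) :
    ∃ g₁ g₂ : ℂ → ℂ,
      (DifferentiableOn ℂ g₁ (Metric.ball 0 1) ∧ DifferentiableOn ℂ g₂ (Metric.ball 0 1) ∧
        g₁ 0 = 1 ∧ g₂ 0 = 1 ∧
        SatisfiesKZ k (fun τ => g₁ (qexp τ)) ∧
        SatisfiesKZ k (fun τ => qpow ((k + 1) / 6) τ * g₂ (qexp τ))) ∧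
      deriv g₁ 0 = ((12 * k * (k + 1) / (5 - k) : ℝ) : ℂ) ∧
      deriv g₂ 0 = ((4 * (k + 1) * (2 * k - 1) / (k + 7) : ℝ) : ℂ) ∧
      ∀ g₁' g₂' : ℂ → ℂ,
        (DifferentiableOn ℂ g₁' (Metric.ball 0 1) ∧ DifferentiableOn ℂ g₂' (Metric.ball 0 1) ∧
          g₁' 0 = 1 ∧ g₂' 0 = 1 ∧
          SatisfiesKZ k (fun τ => g₁' (qexp τ)) ∧
          SatisfiesKZ k (fun τ => qpow ((k + 1) / 6) τ * g₂' (qexp τ))) →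
        Set.EqOn g₁' g₁ (Metric.ball 0 1) ∧ Set.EqOn g₂' g₂ (Metric.ball 0 1) := by
  have hpow : ∀ g : ℂ → ℂ, (fun τ => qpow 0 τ * g (qexp τ)) = fun τ => g (qexp τ) := by
    intro g
    simp [qpow]
  obtain ⟨g₁, hd₁, h₁0, hKZ₁, hc₁, hu₁⟩ := KanekoZagier.exists_unique_solution k 0 (by ring)
    (by linarith)
  obtain ⟨g₂, hd₂, h₂0, hKZ₂, hc₂, hu₂⟩ := KanekoZagier.exists_unique_solution k ((k + 1) / 6)
    (by ring) (by linarith)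
  rw [hpow] at hKZ₁
  refine ⟨g₁, g₂, ⟨hd₁, hd₂, h₁0, h₂0, hKZ₁, hKZ₂⟩, ?_, ?_, ?_⟩
  · have hne : (5 : ℂ) - k ≠ 0 := by exact_mod_cast (by linarith : (0 : ℝ) < 5 - k).ne'
    push_cast at hc₁ ⊢
    rw [eq_div_iff hne]
    linear_combination 6 * hc₁
  · have hne : (k : ℂ) + 7 ≠ 0 := by exact_mod_cast (by linarith : (0 : ℝ) < k + 7).ne'
    push_cast at hc₂ ⊢
    rw [eq_div_iff hne]
    linear_combination 6 * hc₂
  · rintro g₁' g₂' ⟨hd₁', hd₂', h₁0', h₂0', hKZ₁', hKZ₂'⟩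
    exact ⟨hu₁ g₁' hd₁' h₁0' (by rwa [hpow]), hu₂ g₂' hd₂' h₂0' hKZ₂'⟩
end

section
/- Let k ∈ (1/2)ℤ with 0 < k < 4 and set α := (k+1)/6 (so that 24α = 4(k+1) is an integer). Let g₁ and g₂ be holomorphic functions on the open unit disc with g₁(0) = g₂(0) = 1 such that f₁(τ) := g₁(e^{2πiτ}) and f₂(τ) := e^{2πiατ}·g₂(e^{2πiτ}) both satisfy the Kaneko–Zagier equation of weight k. Then the Wronskian satisfies f₁·∂_k f₂ − f₂·∂_k f₁ = α·η^{4(k+1)} identically on ℍ. -/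
open Complex

open scoped Topology
open UpperHalfPlane (upperHalfPlaneSet isOpen_upperHalfPlaneSet)

lemma qexp_eq_qParam : qexp = Function.Periodic.qParam 1 := by
  ext τ
  simp [qexp, Function.Periodic.qParam]

lemma qpow_eq_qParam_pow (n : ℕ) (τ : ℂ) :
    qpow (n / 24) τ = Function.Periodic.qParam 24 τ ^ n := by
  rw [qpow, Function.Periodic.qParam, ← Complex.exp_nat_mul]
  congr 1
  push_cast
  ring

lemma η_eq_eta : η = ModularForm.eta := by
  ext τ
  have h := qpow_eq_qParam_pow 1 τ
  rw [Nat.cast_one, pow_one] at h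
  rw [η, ModularForm.eta, h, qexp_eq_qParam]

lemma E2_eq_eisensteinE2 (z : UpperHalfPlane) : E2 z = EisensteinSeries.E2 z := by
  rw [EisensteinSeries.E2_eq_tsum_cexp,
    tsum_pnat_eq_tsum_succ (f := fun n ↦
      (ArithmeticFunction.sigma 1 n : ℂ) * cexp (2 * Real.pi * I * z) ^ n)]
  simp only [E2, sigma', qexp, ArithmeticFunction.sigma_apply]

lemma differentiableOn_η : DifferentiableOn ℂ η upperHalfPlaneSet := fun τ hτ ↦ by
  rw [η_eq_eta]
  exact (ModularForm.differentiableAt_eta_of_mem_upperHalfPlaneSet hτ).differentiableWithinAt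

lemma η_ne_zero {τ : ℂ} (hτ : τ ∈ upperHalfPlaneSet) : η τ ≠ 0 := by
  rw [η_eq_eta]
  exact ModularForm.eta_ne_zero hτ

lemma deriv_η {τ : ℂ} (hτ : τ ∈ upperHalfPlaneSet) :
    deriv η τ = Real.pi * I / 12 * E2 τ * η τ := by
  have h := ModularForm.logDeriv_eta_eq_E2 ⟨τ, hτ⟩
  rw [← E2_eq_eisensteinE2, ← η_eq_eta, logDeriv_apply] at h
  exact (div_eq_iff (η_ne_zero hτ)).1 h

lemma differentiableOn_E2 : DifferentiableOn ℂ E2 upperHalfPlaneSet := by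
  have h : DifferentiableOn ℂ (fun τ ↦ deriv η τ / (Real.pi * I / 12 * η τ)) upperHalfPlaneSet :=
    (differentiableOn_η.deriv isOpen_upperHalfPlaneSet).div (differentiableOn_η.const_mul _)
      fun τ hτ ↦ mul_ne_zero (by simp [Real.pi_ne_zero]) (η_ne_zero hτ)
  refine h.congr fun τ hτ ↦ ?_
  have hη := η_ne_zero hτ
  have hπ : (Real.pi : ℂ) ≠ 0 := by simp [Real.pi_ne_zero]
  rw [deriv_η hτ]
  field_simp

lemma differentiableOn_partialD {f : ℂ → ℂ} (k : ℂ)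
    (hf : DifferentiableOn ℂ f upperHalfPlaneSet) :
    DifferentiableOn ℂ (partialD k f) upperHalfPlaneSet :=
  ((hf.deriv isOpen_upperHalfPlaneSet).div_const _).sub
    ((differentiableOn_E2.const_mul _).mul hf)

lemma deriv_eq_partialD (k : ℂ) (f : ℂ → ℂ) (τ : ℂ) :
    deriv f τ = 2 * Real.pi * I * (partialD k f τ + k / 12 * E2 τ * f τ) := by
  rw [partialD, sub_add_cancel, Dq, mul_div_cancel₀ _ Complex.two_pi_I_ne_zero]

/-- The Wronskian of two solutions of the Kaneko–Zagier equation of weight `k` satisfies the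
first-order equation of which `η ^ (4 * (k + 1))` is a solution. -/
lemma hasDerivAt_wronskian {k : ℝ} {f₁ f₂ : ℂ → ℂ}
    (hd₁ : DifferentiableOn ℂ f₁ upperHalfPlaneSet)
    (hd₂ : DifferentiableOn ℂ f₂ upperHalfPlaneSet)
    (hf₁ : SatisfiesKZ k f₁) (hf₂ : SatisfiesKZ k f₂) {τ : ℂ} (hτ : τ ∈ upperHalfPlaneSet) :
    HasDerivAt (fun t ↦ f₁ t * partialD k f₂ t - f₂ t * partialD k f₁ t)
      (2 * Real.pi * I * ((k + 1) / 6) * E2 τ *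
        (f₁ τ * partialD k f₂ τ - f₂ τ * partialD k f₁ τ)) τ := by
  have hn := isOpen_upperHalfPlaneSet.mem_nhds hτ
  have h := ((hd₁.hasDerivAt hn).mul
    ((differentiableOn_partialD k hd₂).hasDerivAt hn)).sub
    ((hd₂.hasDerivAt hn).mul ((differentiableOn_partialD k hd₁).hasDerivAt hn))
  refine h.congr_deriv ?_
  rw [deriv_eq_partialD k f₁, deriv_eq_partialD k f₂, deriv_eq_partialD (k + 2) (partialD k f₁),
    deriv_eq_partialD (k + 2) (partialD k f₂), hf₁ τ hτ, hf₂ τ hτ]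
  ring

lemma exists_eq_mul_η_pow {W : ℂ → ℂ} (n : ℕ)
    (hW : ∀ τ ∈ upperHalfPlaneSet, HasDerivAt W (2 * Real.pi * I * (n / 24) * E2 τ * W τ) τ) :
    ∃ c, ∀ τ ∈ upperHalfPlaneSet, W τ = c * η τ ^ n := by
  have hd (τ) (hτ : τ ∈ upperHalfPlaneSet) : HasDerivAt (fun t ↦ W t / η t ^ n) 0 τ := by
    have hη := η_ne_zero hτ
    refine ((hW τ hτ).div ((differentiableOn_η.hasDerivAt
      (isOpen_upperHalfPlaneSet.mem_nhds hτ)).pow n) (pow_ne_zero n hη)).congr_deriv ?_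
    rw [deriv_η hτ, div_eq_zero_iff]
    left
    rcases n with _ | n
    · simp
    · simp only [Pi.pow_apply, Nat.add_sub_cancel, pow_succ]
      ring
  obtain ⟨c, hc⟩ := isOpen_upperHalfPlaneSet.exists_is_const_of_deriv_eq_zero
    (convex_halfSpace_im_gt 0).isPreconnected
    (fun τ hτ ↦ (hd τ hτ).differentiableAt.differentiableWithinAt) (fun τ hτ ↦ (hd τ hτ).deriv)
  exact ⟨c, fun τ hτ ↦ (div_eq_iff (pow_ne_zero n (η_ne_zero hτ))).1 (hc τ hτ)⟩

lemma qexp_mem_ball {τ : ℂ} (hτ : τ ∈ upperHalfPlaneSet) : qexp τ ∈ Metric.ball (0 : ℂ) 1 := by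
  rw [qexp_eq_qParam, mem_ball_zero_iff]
  exact_mod_cast UpperHalfPlane.norm_qParam_lt_one 1 ⟨τ, hτ⟩

lemma hasDerivAt_qpow (s : ℝ) (τ : ℂ) :
    HasDerivAt (qpow s) (2 * Real.pi * I * s * qpow s τ) τ :=
  (((hasDerivAt_id τ).const_mul (2 * Real.pi * I * s : ℂ)).cexp).congr_deriv (by
    simp [qpow, mul_comm])

lemma hasDerivAt_qexp (τ : ℂ) : HasDerivAt qexp (2 * Real.pi * I * qexp τ) τ :=
  (((hasDerivAt_id τ).const_mul (2 * Real.pi * I : ℂ)).cexp).congr_deriv (by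
    simp [qexp, mul_comm])

lemma hasDerivAt_comp_qexp {g : ℂ → ℂ} (hg : DifferentiableOn ℂ g (Metric.ball 0 1)) {τ : ℂ}
    (hτ : τ ∈ upperHalfPlaneSet) :
    HasDerivAt (fun t ↦ g (qexp t)) (2 * Real.pi * I * (qexp τ * deriv g (qexp τ))) τ :=
  ((hg.hasDerivAt (Metric.isOpen_ball.mem_nhds (qexp_mem_ball hτ))).comp τ
    (hasDerivAt_qexp τ)).congr_deriv (by ring)

lemma hasDerivAt_qpow_mul_comp_qexp (s : ℝ) {g : ℂ → ℂ}
    (hg : DifferentiableOn ℂ g (Metric.ball 0 1)) {τ : ℂ} (hτ : τ ∈ upperHalfPlaneSet) :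
    HasDerivAt (fun t ↦ qpow s t * g (qexp t))
      (2 * Real.pi * I * (qpow s τ * (s * g (qexp τ) + qexp τ * deriv g (qexp τ)))) τ :=
  ((hasDerivAt_qpow s τ).mul (hasDerivAt_comp_qexp hg hτ)).congr_deriv (by ring)

lemma wronskian_eq_qpow_mul (k : ℂ) (s : ℝ) {g₁ g₂ : ℂ → ℂ}
    (hg₁ : DifferentiableOn ℂ g₁ (Metric.ball 0 1))
    (hg₂ : DifferentiableOn ℂ g₂ (Metric.ball 0 1)) {τ : ℂ} (hτ : τ ∈ upperHalfPlaneSet) :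
    g₁ (qexp τ) * partialD k (fun t ↦ qpow s t * g₂ (qexp t)) τ -
        qpow s τ * g₂ (qexp τ) * partialD k (fun t ↦ g₁ (qexp t)) τ =
      qpow s τ * (g₁ (qexp τ) * (s * g₂ (qexp τ) + qexp τ * deriv g₂ (qexp τ)) -
        g₂ (qexp τ) * (qexp τ * deriv g₁ (qexp τ))) := by
  simp only [partialD, Dq]
  rw [(hasDerivAt_comp_qexp hg₁ hτ).deriv, (hasDerivAt_qpow_mul_comp_qexp s hg₂ hτ).deriv,
    mul_div_cancel_left₀ _ Complex.two_pi_I_ne_zero,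
    mul_div_cancel_left₀ _ Complex.two_pi_I_ne_zero]
  ring

lemma η_pow_eq (n : ℕ) (τ : ℂ) :
    η τ ^ n = qpow (n / 24) τ * (∏' i : ℕ, (1 - qexp τ ^ (i + 1))) ^ n := by
  have h := qpow_eq_qParam_pow 1 τ
  rw [Nat.cast_one, pow_one] at h
  rw [η, mul_pow, qpow_eq_qParam_pow, h]

/-- Two functions continuous at `0` which agree along `qexp` on the upper half-plane agree
at `0`. -/
lemma eq_zero_of_eq_comp_qexp {u v : ℂ → ℂ} (hu : ContinuousAt u 0) (hv : ContinuousAt v 0)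
    (h : ∀ τ ∈ upperHalfPlaneSet, u (qexp τ) = v (qexp τ)) : u 0 = v 0 := by
  have hq : Filter.Tendsto qexp (Filter.comap im Filter.atTop) (𝓝 0) := by
    rw [qexp_eq_qParam]
    exact (Function.Periodic.qParam_tendsto one_pos).mono_right nhdsWithin_le_nhds
  have : (Filter.comap im Filter.atTop).NeBot :=
    Filter.atTop_neBot.comap_of_surj Complex.im_surjective
  refine tendsto_nhds_unique_of_eventuallyEq (hu.tendsto.comp hq) (hv.tendsto.comp hq) ?_
  filter_upwards [Filter.preimage_mem_comap (Filter.Ioi_mem_atTop (0 : ℝ))] with τ hτ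
  exact h τ hτ

/-- The Wronskian of the two normalized solutions of the Kaneko–Zagier equation of weight
`k` (for half-integral `0 < k < 4`) equals `α η^{4(k+1)}` with `α = (k+1)/6`. -/
theorem KZ_wronskian (k : ℝ) (m : ℤ) (hm : k = m / 2) (hk0 : 0 < k) (hk4 : k < 4)
    (g₁ g₂ : ℂ → ℂ)
    (hg₁ : DifferentiableOn ℂ g₁ (Metric.ball 0 1))
    (hg₂ : DifferentiableOn ℂ g₂ (Metric.ball 0 1))
    (hg₁0 : g₁ 0 = 1) (hg₂0 : g₂ 0 = 1)
    (hf₁ : SatisfiesKZ k (fun τ => g₁ (qexp τ)))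
    (hf₂ : SatisfiesKZ k (fun τ => qpow ((k + 1) / 6) τ * g₂ (qexp τ))) :
    ∀ τ : ℂ, 0 < τ.im →
      (fun t => g₁ (qexp t)) τ *
          partialD (k : ℂ) (fun t => qpow ((k + 1) / 6) t * g₂ (qexp t)) τ -
        (fun t => qpow ((k + 1) / 6) t * g₂ (qexp t)) τ *
          partialD (k : ℂ) (fun t => g₁ (qexp t)) τ =
      (((k + 1) / 6 : ℝ) : ℂ) * η τ ^ (2 * m + 4 : ℤ) := by
  obtain ⟨n, hn⟩ : ∃ n : ℕ, (n : ℤ) = 2 * m + 4 := by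
    have : (0 : ℝ) < m := by linarith
    have : 0 < m := by exact_mod_cast this
    exact ⟨(2 * m + 4).toNat, by omega⟩
  have hnk : (k + 1) / 6 = (n : ℝ) / 24 := by
    have : (n : ℝ) = 2 * m + 4 := by exact_mod_cast hn
    rw [hm, this]
    ring
  have hnk' : ((k : ℂ) + 1) / 6 = n / 24 := by simpa using congrArg Complex.ofReal hnk
  rw [← hn]
  simp only [zpow_natCast]
  rw [hnk] at hf₂ ⊢
  obtain ⟨c, hc⟩ := exists_eq_mul_η_pow n fun τ hτ ↦ hnk' ▸ hasDerivAt_wronskian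
    (fun t ht ↦ (hasDerivAt_comp_qexp hg₁ ht).differentiableAt.differentiableWithinAt)
    (fun t ht ↦
      (hasDerivAt_qpow_mul_comp_qexp _ hg₂ ht).differentiableAt.differentiableWithinAt)
    hf₁ hf₂ hτ
  have h0 : Metric.ball (0 : ℂ) 1 ∈ 𝓝 0 := Metric.ball_mem_nhds 0 one_pos
  have c₁ := hg₁.continuousOn.continuousAt h0
  have c₂ := hg₂.continuousOn.continuousAt h0
  have d₁ := (hg₁.deriv Metric.isOpen_ball).continuousOn.continuousAt h0
  have d₂ := (hg₂.deriv Metric.isOpen_ball).continuousOn.continuousAt h0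
  have hP := ModularForm.differentiableOn_tprod_one_sub_pow.continuousOn.continuousAt h0
  have key := eq_zero_of_eq_comp_qexp
    (u := fun q ↦ g₁ q * (((n / 24 : ℝ) : ℂ) * g₂ q + q * deriv g₂ q) - g₂ q * (q * deriv g₁ q))
    (v := fun q ↦ c * (∏' i : ℕ, (1 - q ^ (i + 1))) ^ n)
    (by fun_prop) (by fun_prop) fun τ hτ ↦ by
      have hq : qpow (n / 24) τ ≠ 0 := Complex.exp_ne_zero _
      refine mul_left_cancel₀ hq ?_
      rw [← wronskian_eq_qpow_mul k _ hg₁ hg₂ hτ, hc τ hτ, η_pow_eq]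
      ring
  have hcα : c = ((n / 24 : ℝ) : ℂ) := by simpa [hg₁0, hg₂0] using key.symm
  exact fun τ hτ ↦ hcα ▸ hc τ hτ
end

section
/- Let R be a commutative ring that is a ℚ-algebra and let S = R[X₁, …, Xₙ] be a polynomial ring over R in finitely many variables. If f₁, …, fₙ ∈ S satisfy the closedness condition ∂fᵢ/∂Xⱼ = ∂fⱼ/∂Xᵢ for all i, j, then there exists g ∈ S such that ∂g/∂Xᵢ = fᵢ for all i (formal Poincaré lemma for polynomial rings). -/
namespace MvPolynomial

theorem coeff_X_mul_pderiv {σ R : Type*} [CommSemiring R] (i : σ) (p : MvPolynomial σ R)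
    (m : σ →₀ ℕ) : coeff m (X i * pderiv i p) = m i * coeff m p := by
  classical
  induction p using MvPolynomial.induction_on' with
  | monomial u a =>
    rw [X_mul_pderiv_monomial, coeff_smul, coeff_monomial]
    split_ifs with hu
    · rw [hu, nsmul_eq_mul]
    · simp
  | add p q hp hq => simp only [map_add, mul_add, coeff_add, hp, hq]

/-- Division of the coefficient of each monomial by its total degree. -/
theorem exists_coeff_eq_inv_degree_smul {σ R : Type*} [CommSemiring R] [Algebra ℚ R]
    (p : MvPolynomial σ R) :
    ∃ q : MvPolynomial σ R, ∀ m, coeff m q = (m.degree : ℚ)⁻¹ • coeff m p := by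
  classical
  refine ⟨∑ m ∈ p.support, monomial m ((m.degree : ℚ)⁻¹ • coeff m p), fun m => ?_⟩
  simp only [coeff_sum, coeff_monomial, Finset.sum_ite_eq', mem_support_iff]
  split_ifs with hm
  · rfl
  · rw [not_not.mp hm, smul_zero]

theorem coeff_pderiv_sum_X_mul {σ R : Type*} [Fintype σ] [CommSemiring R]
    {f : σ → MvPolynomial σ R} (h : ∀ i j, pderiv j (f i) = pderiv i (f j)) (j : σ)
    (m : σ →₀ ℕ) :
    coeff m (pderiv j (∑ i, X i * f i)) = ((m.degree + 1 : ℕ) : R) * coeff m (f j) := by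
  classical
  have key : pderiv j (∑ i, X i * f i) = ∑ i, X i * pderiv i (f j) + f j := by
    simp only [map_sum, pderiv_mul, h _ j, pderiv_X, Finset.sum_add_distrib, Pi.single_apply,
      ite_mul, one_mul, zero_mul, Finset.sum_ite_eq', Finset.mem_univ, if_true]
    rw [add_comm]
  rw [key, coeff_add, coeff_sum, Finsupp.degree_eq_sum]
  simp only [coeff_X_mul_pderiv, Nat.cast_add, Nat.cast_sum, Nat.cast_one, add_mul, one_mul,
    Finset.sum_mul]

end MvPolynomial

/-- Formal Poincaré lemma for polynomial rings over a `ℚ`-algebra: a closed family of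
polynomials `f₁, …, fₙ` is a family of partial derivatives of a single polynomial. -/
theorem mvPolynomial_poincare_lemma (R : Type*) [CommRing R] [Algebra ℚ R]
    (n : ℕ) (f : Fin n → MvPolynomial (Fin n) R)
    (h : ∀ i j : Fin n, MvPolynomial.pderiv j (f i) = MvPolynomial.pderiv i (f j)) :
    ∃ g : MvPolynomial (Fin n) R, ∀ i : Fin n, MvPolynomial.pderiv i g = f i := by
  obtain ⟨g, hg⟩ :=
    MvPolynomial.exists_coeff_eq_inv_degree_smul (∑ i, MvPolynomial.X i * f i)
  refine ⟨g, fun j => MvPolynomial.ext _ _ fun m => ?_⟩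
  have hm := MvPolynomial.coeff_pderiv_sum_X_mul h j m
  rw [MvPolynomial.coeff_pderiv] at hm ⊢
  have hd : ((m.degree + 1 : ℕ) : ℚ) ≠ 0 := Nat.cast_ne_zero.mpr m.degree.succ_ne_zero
  rw [hg, map_add, Finsupp.degree_single, smul_mul_assoc, hm, ← nsmul_eq_mul,
    ← Nat.cast_smul_eq_nsmul ℚ, inv_smul_smul₀ hd]
end
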